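/- Let N ≥ 2 be an integer, and let q_1 < q_2 < ⋯ be the first coordinates of all N-solutions (x, m) in which x is a prime number. Then Σ_{i ≥ 2} 1/q_i < 0.73194, i.e., the sum of 1/q over all prime N-solutions (q, m) with q > q_1 is strictly less than 0.73194. -/

import Mathlib

/-- For an integer `N ≥ 2`, a pair `(x, m)` with `x ≥ 2`, `m ≥ 2` is an `N`-solution if
`(x^m - 1)/(x - 1) = 1 + x + ⋯ + x^(m-1) = N`. -/
def IsNSol (N x m : ℕ) : Prop :=
  2 ≤ x ∧ 2 ≤ m ∧ ∑ i ∈ Finset.range m, x ^ i = N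

/-- The sequence `w ↦ binom(w, a) η ^ w` for `η ≡ 1 mod p` has highly divisible differences. -/
theorem pow_dvd_fwdDiff_choose_mul_pow {p η : ℤ} (h : p ∣ η - 1) (j : ℕ) :
    ∀ a w : ℕ, p ^ (j - a) ∣ (fwdDiff 1)^[j] (fun w : ℕ => (w.choose a : ℤ) * η ^ w) w := by
  induction j with
  | zero => intro a w; simp
  | succ j ih =>
    intro a w
    rw [Function.iterate_succ_apply]
    cases a with
    | zero =>
      have : fwdDiff 1 (fun w : ℕ => (w.choose 0 : ℤ) * η ^ w)
          = (η - 1) • (fun w : ℕ => (w.choose 0 : ℤ) * η ^ w) := by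
        ext w; simp [fwdDiff, pow_succ]; ring
      rw [this, fwdDiff_iter_const_smul, Pi.smul_apply, smul_eq_mul]
      have := ih 0 w
      rw [Nat.sub_zero] at this ⊢
      rw [pow_succ']
      exact mul_dvd_mul h this
    | succ a =>
      have : fwdDiff 1 (fun w : ℕ => (w.choose (a + 1) : ℤ) * η ^ w)
          = (η - 1) • (fun w : ℕ => (w.choose (a + 1) : ℤ) * η ^ w)
            + η • (fun w : ℕ => (w.choose a : ℤ) * η ^ w) := by
        ext w; simp [fwdDiff, pow_succ, Nat.choose_succ_succ]; ring
      rw [this, fwdDiff_iter_add, fwdDiff_iter_const_smul, fwdDiff_iter_const_smul]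
      simp only [Pi.add_apply, Pi.smul_apply, smul_eq_mul]
      refine dvd_add ?_ (Dvd.dvd.mul_left ?_ _)
      · rcases Nat.lt_or_ge j (a + 1) with hj | hj
        · rw [Nat.sub_eq_zero_of_le (by omega)]; simp
        · rw [show j + 1 - (a + 1) = (j - (a + 1)) + 1 by omega, pow_succ']
          exact mul_dvd_mul h (ih _ _)
      · rw [show j + 1 - (a + 1) = j - a by omega]
        exact ih _ _

theorem exists_newton_expansion {p η : ℤ} (h : p ∣ η - 1) (D a : ℕ) :
    ∃ c R : ℕ → ℤ, ∀ w : ℕ, p ^ a * ((w.choose a : ℤ) * η ^ w)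
      = ∑ j ∈ Finset.range D, p ^ j * ((w.choose j : ℤ) * c j) + p ^ D * R w := by
  set f : ℕ → ℤ := fun w : ℕ => (w.choose a : ℤ) * η ^ w with hf
  have key : ∀ j, ∃ d, p ^ a * (fwdDiff 1)^[j] f 0 = p ^ j * d := by
    intro j
    have h1 : p ^ j ∣ p ^ a * p ^ (j - a) := by
      rw [← pow_add]; exact pow_dvd_pow _ (by omega)
    exact h1.trans (mul_dvd_mul_left _ (pow_dvd_fwdDiff_choose_mul_pow h j a 0))
  choose c hc using key
  refine ⟨c, fun w => ∑ j ∈ (Finset.range (w + 1)).filter (fun j => D ≤ j),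
    p ^ (j - D) * ((w.choose j : ℤ) * c j), fun w => ?_⟩
  have h0 := shift_eq_sum_fwdDiff_iter 1 f w 0
  simp only [zero_add, smul_eq_mul, mul_one, nsmul_eq_mul] at h0
  have h1 : p ^ a * f w = ∑ j ∈ Finset.range (w + 1), p ^ j * ((w.choose j : ℤ) * c j) := by
    rw [h0, Finset.mul_sum]
    refine Finset.sum_congr rfl fun j _ => ?_
    rw [mul_left_comm, hc]; ring
  change p ^ a * f w = _
  rw [h1, ← Finset.sum_filter_add_sum_filter_not (Finset.range (w + 1)) (fun j => D ≤ j), add_comm]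
  congr 1
  · apply Finset.sum_subset_zero_on_sdiff
    · intro j hj
      simp at hj ⊢; omega
    · intro j hj
      simp at hj
      rw [Nat.choose_eq_zero_of_lt (by omega)]; simp
    · intros; rfl
  · rw [Finset.mul_sum]
    refine Finset.sum_congr rfl fun j hj => ?_
    simp at hj
    rw [← mul_assoc (p ^ D), ← pow_add]
    congr 2; omega

/-- The sum of `D` integers in `[0, D]` that are distinct unless equal to `D`. -/
theorem sum_range_le_sum_of_injective_below {ι : Type*} [Fintype ι] {D : ℕ}
    (hD : Fintype.card ι = D) (τ : ι → Fin (D + 1))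
    (hτ : ∀ c c', τ c = τ c' → (τ c : ℕ) < D → c = c') :
    ∑ j ∈ Finset.range D, j ≤ ∑ c, (τ c : ℕ) := by
  classical
  set s : Finset ι := Finset.univ.filter fun c => (τ c : ℕ) < D with hs
  set t : Finset ℕ := s.image fun c => (τ c : ℕ) with ht
  have hinj : Set.InjOn (fun c => (τ c : ℕ)) (s : Set ι) := by
    intro c hc c' _ h
    simp [hs] at hc
    exact hτ c c' (Fin.ext h) hc
  have hts : t ⊆ Finset.range D := by
    intro j hj
    simp [ht, hs] at hj ⊢
    obtain ⟨c, hc, rfl⟩ := hj; exact hc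
  have hcard : t.card = s.card := Finset.card_image_of_injOn hinj
  have h1 : ∑ j ∈ t, j = ∑ c ∈ s, (τ c : ℕ) := by
    rw [ht, Finset.sum_image hinj]
  rw [← Finset.sum_sdiff hts, ← Finset.sum_add_sum_compl s, h1, add_comm]
  gcongr 1
  calc ∑ j ∈ Finset.range D \ t, j ≤ ∑ j ∈ Finset.range D \ t, D :=
        Finset.sum_le_sum fun j hj => by simp at hj; omega
    _ = sᶜ.card * D := by
        rw [Finset.sum_const, Finset.card_sdiff_of_subset hts, hcard, Finset.card_compl, hD,
          Finset.card_range, smul_eq_mul]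
    _ = ∑ c ∈ sᶜ, D := by rw [Finset.sum_const, smul_eq_mul]
    _ ≤ _ := Finset.sum_le_sum fun c hc => by simp [hs] at hc; exact hc

theorem pow_dvd_det_of_expansion {ι : Type*} [Fintype ι] [DecidableEq ι] {D : ℕ}
    (hD : Fintype.card ι = D) (p : ℤ) (M : Matrix ι ι ℤ) (X : ℕ → ι → ℤ) (C : ℕ → ι → ℤ)
    (R : ι → ι → ℤ)
    (hM : ∀ i c, M i c = ∑ j ∈ Finset.range D, p ^ j * (X j i * C j c) + p ^ D * R i c) :
    p ^ (∑ j ∈ Finset.range D, j) ∣ M.det := by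
  set y : ι → Fin (D + 1) → ι → ℤ := fun c j i => if (j : ℕ) < D then X j i * C j c else R i c
    with hy
  have hM' : M.transpose = fun c => ∑ j : Fin (D + 1), (p ^ (j : ℕ)) • y c j := by
    ext c i
    rw [Matrix.transpose_apply, hM, Finset.sum_apply, Fin.sum_univ_castSucc, ← Fin.sum_univ_eq_sum_range
      (fun j => p ^ j * (X j i * C j c))]
    simp [hy]
  have h1 : M.det = ∑ τ : ι → Fin (D + 1),
      (∏ c, p ^ (τ c : ℕ)) * Matrix.det (Matrix.of fun c => y c (τ c)) := by
    rw [← Matrix.det_transpose, hM']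
    have := (Matrix.detRowAlternating (R := ℤ) (n := ι)).toMultilinearMap.map_sum
      (fun (c : ι) (j : Fin (D + 1)) => (p ^ (j : ℕ)) • y c j)
    refine this.trans (Finset.sum_congr rfl fun τ _ => ?_)
    exact (Matrix.detRowAlternating (R := ℤ) (n := ι)).toMultilinearMap.map_smul_univ
      (fun c => p ^ (τ c : ℕ)) (fun c => y c (τ c))
  rw [h1]
  refine Finset.dvd_sum fun τ _ => ?_
  by_cases hτ : ∀ c c', τ c = τ c' → (τ c : ℕ) < D → c = c'
  · rw [Finset.prod_pow_eq_pow_sum]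
    exact Dvd.dvd.mul_right (pow_dvd_pow _ (sum_range_le_sum_of_injective_below hD τ hτ)) _
  · push Not at hτ
    obtain ⟨c, c', h, hlt, hne⟩ := hτ
    have : Matrix.det (Matrix.of fun c => y c (τ c)) = 0 := by
      have hrow : ∀ c, (τ c : ℕ) < D → y c (τ c) = C (τ c) c • X (τ c) := by
        intro c hc; ext i; simp [hy, hc, mul_comm]
      refine Matrix.exists_vecMul_eq_zero_iff.mp ?_
      by_cases h0 : C (τ c) c = 0
      · refine ⟨Pi.single c 1, by simp, ?_⟩
        rw [Matrix.single_one_vecMul]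
        change y c (τ c) = 0
        rw [hrow c hlt, h0, zero_smul]
      · refine ⟨Pi.single c (C (τ c) c') - Pi.single c' (C (τ c) c), ?_, ?_⟩
        · intro h2
          have := congrFun h2 c'
          simp [hne.symm, h0] at this
        · rw [Matrix.sub_vecMul, Matrix.single_vecMul, Matrix.single_vecMul]
          change C (τ c) c' • y c (τ c) - C (τ c) c • y c' (τ c') = 0
          rw [hrow c hlt, hrow c' (h ▸ hlt), ← h, smul_smul, smul_smul, mul_comm, sub_self]
    rw [this, mul_zero]; exact dvd_zero _

theorem abs_det_le_of_col_le {ι : Type*} [Fintype ι] [DecidableEq ι] (M : Matrix ι ι ℤ)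
    (K : ι → ℤ) (h : ∀ i c, |M i c| ≤ K c) :
    |M.det| ≤ (Fintype.card ι).factorial * ∏ c, K c := by
  rw [Matrix.det_apply]
  refine (Finset.abs_sum_le_sum_abs _ _).trans ?_
  calc _ ≤ ∑ σ : Equiv.Perm ι, ∏ c, K c := Finset.sum_le_sum fun σ _ => ?_
    _ = _ := by rw [Finset.sum_const, Finset.card_univ, Fintype.card_perm, nsmul_eq_mul]
  have : |Equiv.Perm.sign σ • ∏ i, M (σ i) i| = |∏ i, M (σ i) i| := by
    rcases Int.units_eq_one_or (Equiv.Perm.sign σ) with h | h <;> simp [h]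
  rw [this, Finset.abs_prod]
  exact Finset.prod_le_prod (fun _ _ => abs_nonneg _) fun c _ => h _ _

theorem exists_submatrix_det_ne_zero {P ι : Type*} [Fintype P] [Fintype ι] [DecidableEq ι]
    (E : Matrix P ι ℚ) (h : ∀ x, E.mulVec x = 0 → x = 0) :
    ∃ f : ι → P, (E.submatrix f id).det ≠ 0 := by
  have hinj : Function.Injective E.mulVec := by
    intro x y hxy
    have := h (x - y) (by rw [Matrix.mulVec_sub, hxy, sub_self])
    exact sub_eq_zero.mp this
  have hcol : LinearIndependent ℚ E.col := Matrix.mulVec_injective_iff.mp hinj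
  have hrank : E.rank = Fintype.card ι := by
    rw [← Matrix.rank_transpose]
    exact LinearIndependent.rank_matrix (M := E.transpose) hcol
  rw [Matrix.rank_eq_finrank_span_row] at hrank
  obtain ⟨g, hg, -, hli⟩ := Submodule.exists_fun_fin_finrank_span_eq ℚ (Set.range E.row)
  choose k hk using hg
  let e : ι ≃ Fin (Module.finrank ℚ (Submodule.span ℚ (Set.range E.row))) :=
    Fintype.equivOfCardEq (by rw [hrank, Fintype.card_fin])
  refine ⟨fun i => k (e i), ?_⟩
  have h1 : LinearIndependent ℚ (E.submatrix (fun i => k (e i)) id).row := by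
    have : (E.submatrix (fun i => k (e i)) id).row = g ∘ e := by
      ext i j
      rw [Function.comp_apply, ← hk]; rfl
    rw [this]
    exact hli.comp e e.injective
  have := Matrix.linearIndependent_rows_iff_isUnit.mp h1
  rw [Matrix.isUnit_iff_isUnit_det] at this
  exact this.ne_zero

open Polynomial in
theorem coeff_prod_sum_of_natDegree_le {ι : Type*} (s : Finset ι) (f : ι → ℚ[X]) (d : ι → ℕ)
    (h : ∀ i ∈ s, (f i).natDegree ≤ d i) :
    (∏ i ∈ s, f i).coeff (∑ i ∈ s, d i) = ∏ i ∈ s, (f i).coeff (d i) := by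
  classical
  induction s using Finset.induction_on with
  | empty => simp
  | insert a s ha ih =>
    rw [Finset.prod_insert ha, Finset.sum_insert ha, Finset.prod_insert ha,
      ← ih fun i hi => h i (Finset.mem_insert_of_mem hi)]
    refine coeff_mul_add_eq_of_natDegree_le (h a (Finset.mem_insert_self _ _)) ?_
    exact (natDegree_prod_le _ _).trans
      (Finset.sum_le_sum fun i hi => h i (Finset.mem_insert_of_mem hi))

open Polynomial in
/-- A nonzero polynomial in two variables cannot vanish on too many translated points
`(w + i, ρ ^ i y)`. -/
theorem not_vanish_on_translates {A B : ℕ} (p : Fin B → ℚ[X]) (hdeg : ∀ b, (p b).natDegree < A)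
    (hp : p ≠ 0) {κ : Type*} (Q : Finset κ) (w : κ → ℕ) (hw : Set.InjOn w Q) (y : κ → ℚ)
    (hy : ∀ q ∈ Q, y q ≠ 0) (hQ : A * B ≤ Q.card) (ρ : ℚ) (hρ : Function.Injective fun b : ℕ => ρ ^ b)
    (h : ∀ q ∈ Q, ∀ i < B,
      ∑ b, (p b).eval (((w q + i : ℕ) : ℚ)) * (ρ ^ i * y q) ^ (b : ℕ) = 0) : False := by
  classical
  set J : Finset (Fin B) := Finset.univ.filter fun b => p b ≠ 0 with hJ
  have hJne : 0 < J.card := by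
    obtain ⟨b, hb⟩ := Function.ne_iff.mp hp
    exact Finset.card_pos.mpr ⟨b, by simpa [hJ] using hb⟩
  have hJB : J.card ≤ B := by simpa using Finset.card_le_univ J
  set e : Fin J.card ≃ J := J.equivFin.symm with he
  have hpe : ∀ k, p (e k) ≠ 0 := fun k => by
    exact (Finset.mem_filter.mp (e k).2).2
  set M : Matrix (Fin J.card) (Fin J.card) ℚ[X] := Matrix.of fun i k =>
    (p (e k)).comp (X + C ((i : ℕ) : ℚ)) * C ((ρ ^ ((e k : Fin B) : ℕ)) ^ (i : ℕ)) with hM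
  have hdegM : ∀ i k, (M i k).natDegree ≤ (p (e k)).natDegree := by
    intro i k
    refine (natDegree_mul_C_le ((p (e k)).comp (X + C ((i : ℕ) : ℚ))) _).trans ?_
    rw [natDegree_comp, natDegree_X_add_C, mul_one]
  have hcoeffM : ∀ i k, (M i k).coeff (p (e k)).natDegree
      = (p (e k)).leadingCoeff * (ρ ^ ((e k : Fin B) : ℕ)) ^ (i : ℕ) := by
    intro i k
    rw [hM, Matrix.of_apply, coeff_mul_C]
    congr 1
    have h1 : ((p (e k)).comp (X + C ((i : ℕ) : ℚ))).natDegree = (p (e k)).natDegree := by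
      rw [natDegree_comp, natDegree_X_add_C, mul_one]
    have h2 := leadingCoeff_comp (p := p (e k)) (q := X + C ((i : ℕ) : ℚ))
      (by rw [natDegree_X_add_C]; exact one_ne_zero)
    rw [leadingCoeff_X_add_C, one_pow, mul_one, leadingCoeff, h1] at h2
    exact h2
  have hdet_ne : M.det ≠ 0 := by
    have hc : M.det.coeff (∑ k, (p (e k)).natDegree)
        = (∏ k, (p (e k)).leadingCoeff)
          * (Matrix.vandermonde fun k => ρ ^ ((e k : Fin B) : ℕ)).det := by
      rw [← Matrix.det_transpose (Matrix.vandermonde _), ← Matrix.det_mul_row, Matrix.det_apply,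
        Matrix.det_apply, finsetSum_coeff]
      refine Finset.sum_congr rfl fun σ _ => ?_
      rw [coeff_smul, coeff_prod_sum_of_natDegree_le _ _ _ fun k _ => hdegM _ _]
      congr 1
      exact Finset.prod_congr rfl fun k _ => hcoeffM _ _
    intro h0
    rw [h0, coeff_zero] at hc
    have h1 : (Matrix.vandermonde fun k => ρ ^ ((e k : Fin B) : ℕ)).det ≠ 0 := by
      rw [Matrix.det_vandermonde_ne_zero_iff]
      intro k k' hkk
      exact e.injective (Subtype.ext (Fin.ext (hρ hkk)))
    have h2 : (∏ k, (p (e k)).leadingCoeff) ≠ 0 :=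
      Finset.prod_ne_zero_iff.mpr fun k _ => leadingCoeff_ne_zero.mpr (hpe k)
    exact mul_ne_zero h2 h1 hc.symm
  have hdet_deg : M.det.natDegree < A * B := by
    have hA : 1 ≤ A := (Nat.zero_le _).trans_lt (hdeg (e ⟨0, hJne⟩))
    have : M.det.natDegree ≤ J.card * (A - 1) := by
      rw [Matrix.det_apply]
      refine natDegree_sum_le_of_forall_le _ _ fun σ _ => ?_
      refine (natDegree_smul_le _ _).trans ((natDegree_prod_le _ _).trans ?_)
      calc _ ≤ ∑ k : Fin J.card, (A - 1) := Finset.sum_le_sum fun k _ =>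
            (hdegM _ _).trans (by have := hdeg (e k); omega)
        _ = _ := by simp
    calc _ ≤ _ := this
      _ < J.card * A := Nat.mul_lt_mul_of_pos_left (by omega) hJne
      _ ≤ A * B := by rw [mul_comm]; gcongr
  have hroot : ∀ q ∈ Q, M.det.eval ((w q : ℕ) : ℚ) = 0 := by
    intro q hq
    rw [← coe_evalRingHom, RingHom.map_det]
    refine Matrix.exists_mulVec_eq_zero_iff.mp ⟨fun k => y q ^ ((e k : Fin B) : ℕ), ?_, ?_⟩
    · intro h0
      exact pow_ne_zero _ (hy q hq) (congrFun h0 ⟨0, hJne⟩)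
    · ext i
      have h1 := h q hq i (i.2.trans_le hJB)
      rw [Pi.zero_apply, ← h1]
      have h2 : ∑ b, (p b).eval (((w q + (i : ℕ) : ℕ) : ℚ)) * (ρ ^ (i : ℕ) * y q) ^ (b : ℕ)
          = ∑ b ∈ J, (p b).eval (((w q + (i : ℕ) : ℕ) : ℚ)) * (ρ ^ (i : ℕ) * y q) ^ (b : ℕ) := by
        refine (Finset.sum_subset (Finset.subset_univ J) fun b _ hb => ?_).symm
        have : p b = 0 := by simpa [hJ] using hb
        simp [this]
      rw [h2, ← Finset.sum_coe_sort J, ← Equiv.sum_comp e, Matrix.mulVec, dotProduct]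
      refine Finset.sum_congr rfl fun k _ => ?_
      simp [hM, mul_pow]
      rw [← pow_mul, ← pow_mul, mul_comm (i : ℕ), mul_assoc]
  refine hdet_ne (eq_zero_of_natDegree_lt_card_of_eval_eq_zero' M.det
    (Q.image fun q => ((w q : ℕ) : ℚ)) ?_ ?_)
  · intro x hx
    obtain ⟨q, hq, rfl⟩ := Finset.mem_image.mp hx
    exact hroot q hq
  · rw [Finset.card_image_of_injOn]
    · omega
    · intro q hq q' hq' hqq
      exact hw hq hq' (Nat.cast_injective (R := ℚ) hqq)

open Polynomial in
theorem exists_polynomial_eval_eq_sum_choose {A : ℕ} (x : Fin A → ℚ) :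
    ∃ P : ℚ[X], (0 < A → P.natDegree < A) ∧
      (∀ w : ℕ, P.eval (w : ℚ) = ∑ a, x a * (w.choose a : ℚ)) ∧ (P = 0 → x = 0) := by
  set P : ℚ[X] := ∑ a : Fin A, C (x a / ((a : ℕ).factorial : ℚ)) * descPochhammer ℚ (a : ℕ) with hP
  have heval : ∀ w : ℕ, P.eval (w : ℚ) = ∑ a, x a * (w.choose a : ℚ) := by
    intro w
    rw [hP, eval_finsetSum]
    refine Finset.sum_congr rfl fun a _ => ?_
    rw [eval_C_mul, descPochhammer_eval_eq_descFactorial, Nat.descFactorial_eq_factorial_mul_choose]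
    have : ((a : ℕ).factorial : ℚ) ≠ 0 := by exact_mod_cast (Nat.factorial_ne_zero _)
    push_cast
    field_simp
  refine ⟨P, fun hA => ?_, heval, fun h0 => ?_⟩
  · refine Nat.lt_of_le_pred hA (natDegree_sum_le_of_forall_le _ _ fun a _ => ?_)
    refine (natDegree_C_mul_le _ _).trans ?_
    rw [descPochhammer_natDegree]
    have := a.2
    simp only [Nat.pred_eq_sub_one]; omega
  · have key : ∀ a : ℕ, ∀ ha : a < A, x ⟨a, ha⟩ = 0 := by
      intro a
      induction a using Nat.strong_induction_on with
      | _ a ih =>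
        intro ha
        have h1 := heval a
        rw [h0, eval_zero, Finset.sum_eq_single ⟨a, ha⟩] at h1
        · simpa using h1.symm
        · intro b _ hb
          rcases lt_trichotomy (b : ℕ) a with hlt | heq | hgt
          · rw [ih b hlt b.2, zero_mul]
          · exact absurd (Fin.ext heq) hb
          · rw [Nat.choose_eq_zero_of_lt hgt]; simp
        · simp
    ext a; exact key a a.2

/-- The exponent `⌈n t / G⌉`. -/
def ceilMulDiv (n G t : ℕ) : ℕ := (n * t + G - 1) / G

theorem le_mul_ceilMulDiv {G : ℕ} (hG : 0 < G) (n t : ℕ) : n * t ≤ G * ceilMulDiv n G t := by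
  have := Nat.lt_mul_div_succ (n * t + G - 1) hG
  unfold ceilMulDiv
  rw [Nat.mul_add] at this
  omega

theorem mul_ceilMulDiv_lt {G : ℕ} (hG : 0 < G) (n t : ℕ) :
    G * ceilMulDiv n G t < n * t + G := by
  have := Nat.mul_div_le (n * t + G - 1) G
  unfold ceilMulDiv
  omega

theorem ceilMulDiv_add_le {G n σ t t' : ℕ} (hG : 0 < G) (hn : G * σ ≤ n) (h : t < t') :
    ceilMulDiv n G t + σ ≤ ceilMulDiv n G t' := by
  have h1 := mul_ceilMulDiv_lt hG n t
  have h2 := le_mul_ceilMulDiv hG n t'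
  have h3 : n * t + n ≤ n * t' := by
    rw [← Nat.mul_succ]; exact Nat.mul_le_mul_left _ h
  have : G * (ceilMulDiv n G t + σ) < G * (ceilMulDiv n G t' + 1) := by
    rw [mul_add, mul_add]; omega
  have := Nat.lt_of_mul_lt_mul_left this
  omega

section Interpolation

variable (r u v n G S T : ℕ)

/-- The value `r ^ t₁ (-u) ^ t v ^ (T - 1 - t)` attached to `(s, t)`. -/
def interpVal (s t : ℕ) : ℤ :=
  (r : ℤ) ^ (G * (s + ceilMulDiv n G t) - n * t) * (-(u : ℤ)) ^ t * (v : ℤ) ^ (T - 1 - t)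

/-- The value complementary to `interpVal`. -/
def interpCoval (s t : ℕ) : ℤ :=
  (r : ℤ) ^ (G * S + n * t - G * (s + ceilMulDiv n G t)) * (-(u : ℤ)) ^ (T - 1 - t) * (v : ℤ) ^ t

variable {r u v n G S T}

theorem mul_add_ceilMulDiv_le (hG : 0 < G) {s t : ℕ} (hs : s < S) :
    G * (s + ceilMulDiv n G t) ≤ G * S + n * t := by
  have h1 := mul_ceilMulDiv_lt hG n t
  have h2 : G * s + G ≤ G * S := by rw [← Nat.mul_succ]; exact Nat.mul_le_mul_left _ hs
  rw [mul_add]; omega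

theorem le_mul_add_ceilMulDiv (hG : 0 < G) (s t : ℕ) :
    n * t ≤ G * (s + ceilMulDiv n G t) := by
  have h1 := le_mul_ceilMulDiv hG n t
  rw [mul_add]; omega

theorem interpVal_mul_interpCoval (hG : 0 < G) {s t : ℕ} (hs : s < S) (ht : t < T) :
    interpVal r u v n G T s t * interpCoval r u v n G S T s t
      = (r : ℤ) ^ (G * S) * (-(u : ℤ)) ^ (T - 1) * (v : ℤ) ^ (T - 1) := by
  have h1 := mul_add_ceilMulDiv_le (n := n) hG (t := t) hs
  have h2 := le_mul_add_ceilMulDiv (n := n) hG s t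
  rw [show G * S = (G * (s + ceilMulDiv n G t) - n * t)
      + (G * S + n * t - G * (s + ceilMulDiv n G t)) by omega]
  have h3 : T - 1 = t + (T - 1 - t) := by omega
  unfold interpVal interpCoval
  rw [pow_add, show (-(u : ℤ)) ^ (T - 1) = (-(u : ℤ)) ^ t * (-(u : ℤ)) ^ (T - 1 - t) by
    rw [← pow_add, ← h3], show (v : ℤ) ^ (T - 1) = (v : ℤ) ^ t * (v : ℤ) ^ (T - 1 - t) by
    rw [← pow_add, ← h3]]
  ring

theorem interpVal_add (hG : 0 < G) (s t i : ℕ) :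
    interpVal r u v n G T (s + i) t = ((r : ℤ) ^ G) ^ i * interpVal r u v n G T s t := by
  have h2 := le_mul_add_ceilMulDiv (n := n) hG s t
  unfold interpVal
  rw [show G * (s + i + ceilMulDiv n G t) - n * t
    = G * i + (G * (s + ceilMulDiv n G t) - n * t) by
      rw [show G * (s + i + ceilMulDiv n G t) = G * i + G * (s + ceilMulDiv n G t) by ring]; omega,
    pow_add, pow_mul]
  ring

theorem interpVal_ne_zero (hr : 0 < r) (hu : 0 < u) (hv : 0 < v) (s t : ℕ) :
    interpVal r u v n G T s t ≠ 0 := by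
  unfold interpVal
  have hr' : (r : ℤ) ≠ 0 := by positivity
  have hu' : (u : ℤ) ≠ 0 := by positivity
  have hv' : (v : ℤ) ≠ 0 := by positivity
  exact mul_ne_zero (mul_ne_zero (pow_ne_zero _ hr') (pow_ne_zero _ (neg_ne_zero.mpr hu')))
    (pow_ne_zero _ hv')

theorem abs_pow_mul_pow_mul_pow_le (hr : 0 < r) (hur : u ≤ r) (hvr : v ≤ r) {x y z E : ℕ}
    (h : x + y + z ≤ E) : |(r : ℤ) ^ x * (-(u : ℤ)) ^ y * (v : ℤ) ^ z| ≤ (r : ℤ) ^ E := by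
  rw [abs_mul, abs_mul, abs_pow, abs_pow, abs_pow, abs_neg, Nat.abs_cast, Nat.abs_cast,
    Nat.abs_cast]
  have hr' : (1 : ℤ) ≤ r := by exact_mod_cast hr
  calc (r : ℤ) ^ x * (u : ℤ) ^ y * (v : ℤ) ^ z ≤ (r : ℤ) ^ x * (r : ℤ) ^ y * (r : ℤ) ^ z := by
        gcongr
    _ = (r : ℤ) ^ (x + y + z) := by rw [pow_add, pow_add]
    _ ≤ _ := pow_le_pow_right₀ hr' h

theorem abs_interpVal_le (hr : 0 < r) (hur : u ≤ r) (hvr : v ≤ r) (hG : 0 < G) {s t : ℕ}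
    (hs : s < S) (ht : t < T) : |interpVal r u v n G T s t| ≤ (r : ℤ) ^ (G * S + T) := by
  have h1 := mul_add_ceilMulDiv_le (n := n) hG (t := t) hs
  exact abs_pow_mul_pow_mul_pow_le hr hur hvr (by omega)

theorem abs_interpCoval_le (hr : 0 < r) (hur : u ≤ r) (hvr : v ≤ r) (hG : 0 < G) {s t : ℕ}
    (ht : t < T) : |interpCoval r u v n G S T s t| ≤ (r : ℤ) ^ (G * S + T) := by
  have h2 := le_mul_add_ceilMulDiv (n := n) hG s t
  exact abs_pow_mul_pow_mul_pow_le hr hur hvr (by omega)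

theorem interpVal_modEq {q : ℤ} (hG : 0 < G) (hcong : q ∣ (r : ℤ) ^ n * v + u) {s t : ℕ}
    (ht : t < T) : interpVal r u v n G T s t
      ≡ (v : ℤ) ^ (T - 1) * ((r : ℤ) ^ G) ^ (s + ceilMulDiv n G t) [ZMOD q] := by
  have h2 := le_mul_add_ceilMulDiv (n := n) hG s t
  have h3 : T - 1 = t + (T - 1 - t) := by omega
  have hc : -(u : ℤ) ≡ (r : ℤ) ^ n * v [ZMOD q] := by
    rw [Int.modEq_iff_dvd]; simpa using hcong
  unfold interpVal
  refine (((hc.pow t).mul_left _).mul_right _).trans ?_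
  rw [← pow_mul, show (r : ℤ) ^ (G * (s + ceilMulDiv n G t))
    = (r : ℤ) ^ (G * (s + ceilMulDiv n G t) - n * t) * (r : ℤ) ^ (n * t) by
      rw [← pow_add]; congr 1; omega, show (v : ℤ) ^ (T - 1) = (v : ℤ) ^ t * (v : ℤ) ^ (T - 1 - t) by
    rw [← pow_add, ← h3], mul_pow, ← pow_mul]
  change _ % q = _ % q
  congr 1; ring

theorem interpCoval_modEq {q ρ' : ℤ} (hG : 0 < G) (hcong : q ∣ (r : ℤ) ^ n * v + u)
    (hρ' : (r : ℤ) ^ G * ρ' ≡ 1 [ZMOD q]) {s t : ℕ} (hs : s < S) (ht : t < T) :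
    interpCoval r u v n G S T s t
      ≡ (r : ℤ) ^ (G * S + n * (T - 1)) * (v : ℤ) ^ (T - 1) * ρ' ^ (s + ceilMulDiv n G t)
        [ZMOD q] := by
  have h1 := mul_add_ceilMulDiv_le (n := n) hG (t := t) hs
  have h3 : T - 1 = t + (T - 1 - t) := by omega
  have h4 : n * (T - 1) = n * t + n * (T - 1 - t) := by rw [← mul_add, ← h3]
  have hc : -(u : ℤ) ≡ (r : ℤ) ^ n * v [ZMOD q] := by
    rw [Int.modEq_iff_dvd]; simpa using hcong
  unfold interpCoval
  refine (((hc.pow _).mul_left _).mul_right _).trans ?_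
  set W := s + ceilMulDiv n G t with hW
  have h5 := (hρ'.pow W).mul_left ((r : ℤ) ^ (G * S + n * t - G * W)
    * ((r : ℤ) ^ n * v) ^ (T - 1 - t) * (v : ℤ) ^ t)
  rw [one_pow, mul_one] at h5
  refine h5.symm.trans ?_
  change _ % q = _ % q
  congr 1
  rw [h4, show G * S + (n * t + n * (T - 1 - t)) = (G * S + n * t - G * W) + G * W
      + n * (T - 1 - t) by omega, show (v : ℤ) ^ (T - 1) = (v : ℤ) ^ t * (v : ℤ) ^ (T - 1 - t) by
    rw [← pow_add, ← h3], pow_add, pow_add, mul_pow, mul_pow, ← pow_mul, ← pow_mul]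
  ring

end Interpolation

section Core

variable (r u v n G S T k : ℕ)

/-- The monomial `Y ^ (b - k)`, with negative powers replaced by powers of the complementary
value. -/
def interpMonomial (s t b : ℕ) : ℤ :=
  interpVal r u v n G T s t ^ (b - k) * interpCoval r u v n G S T s t ^ (k - b)

/-- The interpolation matrix. -/
def interpMatrix (A B : ℕ) : Matrix (Fin S × Fin T) (Fin A × Fin B) ℤ := fun i c =>
  (((i.1 + ceilMulDiv n G i.2 : ℕ).choose c.1 : ℕ) : ℤ) * interpMonomial r u v n G S T k i.1 i.2 c.2

variable {r u v n G S T k}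

theorem exists_interpMonomial_modEq {p : ℤ} {m : ℕ} (hm : 1 ≤ m) (hG : 0 < G)
    (hrG : p ∣ (r : ℤ) ^ G - 1) (hcong : p ^ m ∣ (r : ℤ) ^ n * v + u) (b : ℕ) :
    ∃ c η : ℤ, p ∣ η - 1 ∧ ∀ s < S, ∀ t < T, interpMonomial r u v n G S T k s t b
      ≡ c * η ^ (s + ceilMulDiv n G t) [ZMOD p ^ m] := by
  have hcop : IsCoprime ((r : ℤ) ^ G) (p ^ m) := by
    refine IsCoprime.pow_right ?_
    obtain ⟨x, hx⟩ := hrG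
    exact ⟨1, -x, by linear_combination hx⟩
  obtain ⟨ρ', y, hy⟩ := hcop
  have hρ' : (r : ℤ) ^ G * ρ' ≡ 1 [ZMOD p ^ m] := by
    rw [Int.modEq_iff_dvd]; exact ⟨y, by linear_combination -hy⟩
  have hρ1 : (r : ℤ) ^ G ≡ 1 [ZMOD p] := (Int.modEq_iff_dvd.mpr hrG).symm
  have hρ'1 : ρ' ≡ 1 [ZMOD p] := by
    have h1 : (r : ℤ) ^ G * ρ' ≡ 1 [ZMOD p] := hρ'.of_dvd (dvd_pow_self p (by omega))
    have h2 := hρ1.mul_right ρ'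
    rw [one_mul] at h2
    exact h2.symm.trans h1
  refine ⟨((v : ℤ) ^ (T - 1)) ^ (b - k) * ((r : ℤ) ^ (G * S + n * (T - 1)) * (v : ℤ) ^ (T - 1)) ^ (k - b),
    ((r : ℤ) ^ G) ^ (b - k) * ρ' ^ (k - b), ?_, fun s hs t ht => ?_⟩
  · have := (hρ1.pow (b - k)).mul (hρ'1.pow (k - b))
    rw [one_pow, one_pow, one_mul] at this
    exact Int.modEq_iff_dvd.mp this.symm
  · have h1 := (interpVal_modEq hG hcong (s := s) ht).pow (b - k)
    have h2 := (interpCoval_modEq hG hcong hρ' hs ht).pow (k - b)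
    refine (h1.mul h2).trans ?_
    change _ % _ = _ % _
    congr 1; ring

theorem pow_dvd_det_interpMatrix {p : ℤ} {m A B : ℕ} (hm : 1 ≤ m) (hG : 0 < G)
    (hrG : p ∣ (r : ℤ) ^ G - 1) (hcong : p ^ m ∣ (r : ℤ) ^ n * v + u) (hD : A * B ≤ m)
    (f : Fin A × Fin B → Fin S × Fin T) :
    p ^ (∑ j ∈ Finset.range (A * B), j) ∣ p ^ (B * ∑ a ∈ Finset.range A, a)
      * ((interpMatrix r u v n G S T k A B).submatrix f id).det := by
  have hcol : ∀ c : Fin A × Fin B, ∃ C R : ℕ → ℤ, ∃ R' : Fin S × Fin T → ℤ, ∀ i,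
      p ^ (c.1 : ℕ) * interpMatrix r u v n G S T k A B i c
        = ∑ j ∈ Finset.range (A * B), p ^ j
          * ((((i.1 + ceilMulDiv n G i.2 : ℕ).choose j : ℕ) : ℤ) * C j) + p ^ (A * B) * R' i := by
    intro c
    obtain ⟨d, η, hη, hZ⟩ := exists_interpMonomial_modEq (k := k) (S := S) (T := T) hm hG hrG hcong c.2
    obtain ⟨C, R, hCR⟩ := exists_newton_expansion hη (A * B) c.1
    have h1 : ∀ i : Fin S × Fin T, ∃ e, interpMonomial r u v n G S T k i.1 i.2 c.2
        = d * η ^ ((i.1 : ℕ) + ceilMulDiv n G i.2) + p ^ (A * B) * e := by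
      intro i
      obtain ⟨e, he⟩ := (pow_dvd_pow p hD).trans (hZ i.1 i.1.2 i.2 i.2.2).symm.dvd
      exact ⟨e, by linear_combination he⟩
    choose e he using h1
    refine ⟨fun j => d * C j, R, fun i => d * R (i.1 + ceilMulDiv n G i.2)
      + p ^ (c.1 : ℕ) * (((i.1 + ceilMulDiv n G i.2 : ℕ).choose c.1 : ℕ) : ℤ) * e i, fun i => ?_⟩
    have h2 : ∑ j ∈ Finset.range (A * B), p ^ j
          * ((((i.1 + ceilMulDiv n G i.2 : ℕ).choose j : ℕ) : ℤ) * (d * C j))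
        = d * ∑ j ∈ Finset.range (A * B), p ^ j
          * ((((i.1 + ceilMulDiv n G i.2 : ℕ).choose j : ℕ) : ℤ) * C j) := by
      rw [Finset.mul_sum]
      exact Finset.sum_congr rfl fun j _ => by ring
    rw [h2]
    have h3 := hCR (i.1 + ceilMulDiv n G i.2)
    unfold interpMatrix
    rw [he]
    linear_combination d * h3
  choose C R R' h using hcol
  have hcard : Fintype.card (Fin A × Fin B) = A * B := by simp
  have hmain := pow_dvd_det_of_expansion hcard p
    (Matrix.of fun i c => p ^ (c.1 : ℕ) * interpMatrix r u v n G S T k A B (f i) c)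
    (fun j i => ((((f i).1 + ceilMulDiv n G (f i).2 : ℕ).choose j : ℕ) : ℤ)) (fun j c => C c j)
    (fun i c => R' c (f i)) (fun i c => h c (f i))
  have hdet := Matrix.det_mul_row (fun c : Fin A × Fin B => p ^ (c.1 : ℕ))
    ((interpMatrix r u v n G S T k A B).submatrix f id)
  have hprod : ∏ c : Fin A × Fin B, p ^ (c.1 : ℕ) = p ^ (B * ∑ a ∈ Finset.range A, a) := by
    rw [Finset.prod_pow_eq_pow_sum, Fintype.sum_prod_type]
    congr 1
    rw [Finset.mul_sum, ← Fin.sum_univ_eq_sum_range (fun a => B * a)]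
    simp
  rw [hprod] at hdet
  rw [← hdet]
  exact hmain

theorem abs_det_interpMatrix_le {A B W : ℕ} (hr : 0 < r) (hur : u ≤ r) (hvr : v ≤ r)
    (hG : 0 < G) (hW : ∀ s < S, ∀ t < T, s + ceilMulDiv n G t ≤ W)
    (f : Fin A × Fin B → Fin S × Fin T) :
    |((interpMatrix r u v n G S T k A B).submatrix f id).det| ≤ (A * B).factorial *
      ((∏ a ∈ Finset.range A, (W.choose a : ℤ)) ^ B
        * ((r : ℤ) ^ (G * S + T)) ^ (A * ∑ b ∈ Finset.range B, ((b - k) + (k - b)))) := by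
  have h1 := abs_det_le_of_col_le ((interpMatrix r u v n G S T k A B).submatrix f id)
    (fun c => (W.choose c.1 : ℤ) * ((r : ℤ) ^ (G * S + T)) ^ (((c.2 : ℕ) - k) + (k - c.2))) ?_
  · refine h1.trans (le_of_eq ?_)
    have hcard : Fintype.card (Fin A × Fin B) = A * B := by simp
    rw [hcard, Finset.prod_mul_distrib, Finset.prod_pow_eq_pow_sum, Fintype.sum_prod_type,
      Fintype.prod_prod_type]
    congr 3
    · rw [← Finset.prod_pow, ← Fin.prod_univ_eq_prod_range (fun a => ((W.choose a : ℕ) : ℤ) ^ B)]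
      simp
    · rw [← Fin.sum_univ_eq_sum_range (fun b => (b - k) + (k - b))]
      simp
  · intro i c
    rw [Matrix.submatrix_apply, id]
    unfold interpMatrix interpMonomial
    rw [abs_mul, Nat.abs_cast, abs_mul, abs_pow, abs_pow, pow_add]
    have h2 := hW (f i).1 (f i).1.2 (f i).2 (f i).2.2
    have h3 := abs_interpVal_le (n := n) hr hur hvr hG (f i).1.2 (f i).2.2
    have h4 := abs_interpCoval_le (n := n) (S := S) (s := (f i).1) hr hur hvr hG (f i).2.2
    have h5 : ((((f i).1 + ceilMulDiv n G (f i).2 : ℕ).choose c.1 : ℕ) : ℤ) ≤ (W.choose c.1 : ℤ) := by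
      exact_mod_cast Nat.choose_le_choose _ h2
    gcongr

theorem exists_interpMatrix_det_ne_zero {A B σ : ℕ} (hr : 2 ≤ r) (hu : 0 < u) (hv : 0 < v)
    (hG : 0 < G) (hn : G * σ ≤ n) (hσ : A * B ≤ σ * T) (hS : σ + B ≤ S + 1) (hA : 0 < A) :
    ∃ f, ((interpMatrix r u v n G S T k A B).submatrix f id).det ≠ 0 := by
  have key : ∀ x : Fin A × Fin B → ℚ,
      ((interpMatrix r u v n G S T k A B).map (Int.cast : ℤ → ℚ)).mulVec x = 0 → x = 0 := by
    intro x hx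
    by_contra hne
    set K : ℤ := (r : ℤ) ^ (G * S) * (-(u : ℤ)) ^ (T - 1) * (v : ℤ) ^ (T - 1) with hK
    have hK0 : (K : ℚ) ≠ 0 := by
      have hr' : (r : ℤ) ≠ 0 := by positivity
      have hu' : (u : ℤ) ≠ 0 := by positivity
      have hv' : (v : ℤ) ≠ 0 := by positivity
      exact_mod_cast mul_ne_zero (mul_ne_zero (pow_ne_zero _ hr')
        (pow_ne_zero _ (neg_ne_zero.mpr hu'))) (pow_ne_zero _ hv')
    choose P hPdeg hPeval hP0 using fun b : Fin B =>
      exists_polynomial_eval_eq_sum_choose fun a : Fin A => x (a, b)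
    refine not_vanish_on_translates (A := A)
      (fun b => Polynomial.C ((K : ℚ) ^ (k - (b : ℕ))) * P b) (fun b => ?_) (fun h0 => ?_)
      (Finset.univ : Finset (Fin σ × Fin T)) (fun q => q.1 + ceilMulDiv n G q.2) ?_
      (fun q => (interpVal r u v n G T q.1 q.2 : ℚ)) ?_ ?_ ((r : ℚ) ^ G) ?_ ?_
    · exact (Polynomial.natDegree_C_mul_le _ _).trans_lt (hPdeg b hA)
    · apply hne
      ext ⟨a, b⟩
      have h1 := congrFun h0 b
      simp only [Pi.zero_apply, mul_eq_zero, Polynomial.C_eq_zero] at h1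
      exact congrFun (hP0 b (h1.resolve_left (pow_ne_zero _ hK0))) a
    · intro q _ q' _ hqq
      have hlt : ∀ q q' : Fin σ × Fin T, (q.1 + ceilMulDiv n G q.2 : ℕ) = q'.1 + ceilMulDiv n G q'.2
          → ¬ q.2 < q'.2 := by
        intro q q' h hlt
        have h1 := ceilMulDiv_add_le hG hn (t := q.2) (t' := q'.2) hlt
        have := q.1.2
        omega
      have h2 : q.2 = q'.2 := le_antisymm (not_lt.mp (hlt q' q hqq.symm)) (not_lt.mp (hlt q q' hqq))
      simp only [h2] at hqq
      exact Prod.ext (Fin.ext (by omega)) h2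
    · intro q _
      exact_mod_cast interpVal_ne_zero (by omega) hu hv _ _
    · simpa using hσ
    · have : (1 : ℚ) < (r : ℚ) ^ G := one_lt_pow₀ (by exact_mod_cast hr) hG.ne'
      exact pow_right_injective₀ (by linarith) this.ne'
    · intro q _ i hi
      have hs : (q.1 : ℕ) + i < S := by have := q.1.2; omega
      have h1 := congrFun hx (⟨q.1 + i, hs⟩, q.2)
      rw [Matrix.mulVec, dotProduct, Pi.zero_apply, Fintype.sum_prod_type_right] at h1
      have h2 : (interpVal r u v n G T (q.1 + i) q.2 : ℚ) = ((r : ℚ) ^ G) ^ i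
          * (interpVal r u v n G T q.1 q.2 : ℚ) := by
        rw [interpVal_add hG]; push_cast; rfl
      rw [← h2]
      set Y : ℚ := (interpVal r u v n G T (q.1 + i) q.2 : ℚ) with hY
      have h3 : Y * (interpCoval r u v n G S T (q.1 + i) q.2 : ℚ) = K := by
        rw [hY, hK]; exact_mod_cast interpVal_mul_interpCoval hG hs q.2.2
      set Y' : ℚ := (interpCoval r u v n G S T (q.1 + i) q.2 : ℚ) with hY'
      rw [← mul_zero (Y ^ k), ← h1, Finset.mul_sum]
      refine Finset.sum_congr rfl fun b _ => ?_
      have h4 : Y ^ k * (interpMonomial r u v n G S T k (q.1 + i) q.2 b : ℚ)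
          = (K : ℚ) ^ (k - (b : ℕ)) * Y ^ (b : ℕ) := by
        unfold interpMonomial
        push_cast
        rw [← hY, ← hY', ← h3, mul_pow]
        have : k + (b - k) = (k - b) + b := by omega
        calc Y ^ k * (Y ^ (b - k) * Y' ^ (k - b)) = Y ^ (k + (b - k)) * Y' ^ (k - b) := by
              rw [pow_add]; ring
          _ = _ := by rw [this, pow_add]; ring
      rw [Polynomial.eval_C_mul, show q.1 + ceilMulDiv n G q.2 + i = q.1 + i + ceilMulDiv n G q.2 by ring,
        hPeval, Finset.mul_sum, Finset.mul_sum, Finset.sum_mul]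
      refine Finset.sum_congr rfl fun a _ => ?_
      simp only [interpMatrix, Matrix.map_apply]
      push_cast
      linear_combination (-((q.1 + i + ceilMulDiv n G q.2 : ℕ).choose a : ℚ) * x (a, b)) * h4
  obtain ⟨f, hf⟩ := exists_submatrix_det_ne_zero _ key
  refine ⟨f, fun h0 => hf ?_⟩
  rw [Matrix.submatrix_map]
  have := (Int.castRingHom ℚ).map_det ((interpMatrix r u v n G S T k A B).submatrix f id)
  rw [h0] at this
  simpa using this.symm

/-- The inequality resulting from a nonzero interpolation determinant. -/
theorem interpolation_inequality {p m A B σ : ℕ} (hp : 0 < p) (hr : 2 ≤ r) (hu : 0 < u) (hv : 0 < v)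
    (hur : u ≤ r) (hvr : v ≤ r) (hm : 1 ≤ m) (hG : 0 < G)
    (hrG : (p : ℤ) ∣ (r : ℤ) ^ G - 1) (hcong : (p : ℤ) ^ m ∣ (r : ℤ) ^ n * v + u)
    (hn : G * σ ≤ n) (hD : A * B ≤ m) (hσ : A * B ≤ G * (σ * σ)) (hA : 0 < A) (k : ℕ) :
    p ^ (∑ j ∈ Finset.range (A * B), j) ≤ p ^ (B * ∑ a ∈ Finset.range A, a) * ((A * B).factorial *
      ((∏ a ∈ Finset.range A, (n * σ + σ + B).choose a) ^ B
        * (r ^ (G * (σ + B - 1) + G * σ)) ^ (A * ∑ b ∈ Finset.range B, ((b - k) + (k - b))))) := by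
  obtain ⟨f, hf⟩ := exists_interpMatrix_det_ne_zero (r := r) (u := u) (v := v) (n := n) (G := G)
    (S := σ + B - 1) (T := G * σ) (k := k) (A := A) (B := B) (σ := σ) hr hu hv hG hn
    (by rw [mul_left_comm]; exact hσ) (by omega) hA
  have h1 := pow_dvd_det_interpMatrix (k := k) hm hG hrG hcong hD f
  have h2 := abs_det_interpMatrix_le (n := n) (k := k) (W := n * σ + σ + B) (by omega) hur hvr hG
    (fun s hs t ht => ?_) f
  · have hp' : (0 : ℤ) < p := by exact_mod_cast hp
    have h3 := Int.le_of_dvd (abs_pos.mpr (mul_ne_zero (by positivity) hf)) ((dvd_abs _ _).mpr h1)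
    rw [abs_mul, abs_of_pos (a := (p : ℤ) ^ _) (by positivity)] at h3
    have h4 := h3.trans (mul_le_mul_of_nonneg_left h2 (by positivity))
    exact_mod_cast h4
  · have h5 := mul_ceilMulDiv_lt hG n t
    have h6 : n * t + n ≤ G * (n * σ) := by
      rw [← Nat.mul_succ, mul_left_comm]; exact Nat.mul_le_mul_left _ ht
    have : G * ceilMulDiv n G t < G * (n * σ + 1) := by rw [mul_add]; omega
    have := Nat.lt_of_mul_lt_mul_left this
    omega

end Core

open Real in
theorem log_succ_le_log_add {n : ℕ} (hn : 0 < n) : log ((n + 1 : ℕ) : ℝ) ≤ log n + 1 / n := by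
  have hn' : (0 : ℝ) < n := by exact_mod_cast hn
  have := Real.log_le_sub_one_of_pos (x := ((n + 1 : ℕ) : ℝ) / n) (by positivity)
  rw [Real.log_div (by positivity) (by positivity)] at this
  have h3 : ((n + 1 : ℕ) : ℝ) / n - 1 = 1 / n := by push_cast; field_simp; ring
  linarith

open Real in
theorem mul_log_sub_le_log_factorial {n : ℕ} (hn : 0 < n) :
    n * log n - n + 1 ≤ log n.factorial := by
  induction n, hn using Nat.le_induction with
  | base => simp
  | succ n hn ih =>
    have hn' : (0 : ℝ) < n := by exact_mod_cast hn
    have h2 := mul_le_mul_of_nonneg_left (log_succ_le_log_add hn) hn'.le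
    rw [mul_add, mul_one_div_cancel hn'.ne'] at h2
    rw [Nat.factorial_succ, Nat.cast_mul, Real.log_mul (by positivity) (by positivity)]
    push_cast at h2 ⊢
    linarith

open Real in
/-- A lower bound for superfactorials. -/
theorem sum_log_factorial_ge (A : ℕ) :
    (A * (A - 1) / 2 : ℝ) * (log A - 3 / 2) ≤ ∑ a ∈ Finset.range A, log a.factorial := by
  induction A with
  | zero => simp
  | succ A ih =>
    rw [Finset.sum_range_succ]
    rcases Nat.eq_zero_or_pos A with rfl | hA
    · simp
    have hA' : (1 : ℝ) ≤ A := by exact_mod_cast hA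
    have h1 := mul_log_sub_le_log_factorial hA
    have h2 := log_succ_le_log_add hA
    have h4 : (((A + 1 : ℕ) : ℝ) * (((A + 1 : ℕ) : ℝ) - 1) / 2) * (log ((A + 1 : ℕ) : ℝ) - 3 / 2)
        ≤ ((A + 1) * A / 2) * (log A + 1 / A - 3 / 2) := by
      push_cast at h2 ⊢
      rw [add_sub_cancel_right]
      gcongr
    have h5 : ((A + 1) * A / 2 : ℝ) * (log A + 1 / A - 3 / 2)
        = (A * (A - 1) / 2 : ℝ) * (log A - 3 / 2) + A * (log A - 3 / 2) + (A + 1) / 2 := by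
      field_simp; ring
    refine h4.trans (h5.le.trans ?_)
    linarith

open Real in
theorem sum_log_choose_le {A W : ℕ} (hA : 0 < A) (hW : A ≤ W) :
    ∑ a ∈ Finset.range A, log (W.choose a) ≤ (A * (A - 1) / 2 : ℝ) * (log (W / A) + 3 / 2) := by
  have hA' : (0 : ℝ) < A := by exact_mod_cast hA
  have hW' : (0 : ℝ) < W := by exact_mod_cast hA.trans_le hW
  have h1 : ∀ a ∈ Finset.range A, log (W.choose a) ≤ a * log W - log a.factorial := by
    intro a ha
    have h2 : ((W.choose a : ℕ) : ℝ) ≤ (W : ℝ) ^ a / a.factorial := Nat.choose_le_pow_div a W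
    have h3 : (0 : ℝ) < W.choose a := by
      exact_mod_cast Nat.choose_pos ((Finset.mem_range.mp ha).le.trans hW)
    have hf : (0 : ℝ) < a.factorial := by exact_mod_cast a.factorial_pos
    have := Real.log_le_log h3 h2
    rwa [Real.log_div (by positivity) hf.ne', Real.log_pow] at this
  refine (Finset.sum_le_sum h1).trans ?_
  rw [Finset.sum_sub_distrib, ← Finset.sum_mul]
  have h4 : ∑ a ∈ Finset.range A, (a : ℝ) = A * (A - 1) / 2 := by
    rw [← Nat.cast_sum, Finset.sum_range_id]
    rw [Nat.cast_div (Nat.two_dvd_mul_sub_one A) two_ne_zero, Nat.cast_mul,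
      Nat.cast_sub hA]; push_cast; ring
  rw [h4, Real.log_div hW'.ne' hA'.ne']
  have := sum_log_factorial_ge A
  linarith

open Real in
theorem four_mul_sum_dist_le (B : ℕ) :
    4 * ∑ b ∈ Finset.range B, ((b - B / 2) + (B / 2 - b)) ≤ B ^ 2 := by
  have h : ∀ k, (∑ b ∈ Finset.range (2 * k), ((b - k) + (k - b)) = k ^ 2) := by
    intro k
    rw [two_mul, Finset.sum_range_add]
    have h1 : ∑ b ∈ Finset.range k, ((b - k) + (k - b)) = ∑ b ∈ Finset.range k, (b + 1) := by
      rw [← Finset.sum_range_reflect]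
      refine Finset.sum_congr rfl fun b hb => ?_
      have := Finset.mem_range.mp hb
      omega
    have h2 : ∑ b ∈ Finset.range k, ((k + b - k) + (k - (k + b))) = ∑ b ∈ Finset.range k, b :=
      Finset.sum_congr rfl fun b _ => by omega
    rw [h1, h2, Finset.sum_add_distrib]
    have := Finset.sum_range_id_mul_two k
    simp only [Finset.sum_const, Finset.card_range, smul_eq_mul, mul_one]
    rcases Nat.eq_zero_or_pos k with rfl | hk
    · simp
    · obtain ⟨j, rfl⟩ : ∃ j, k = j + 1 := ⟨k - 1, by omega⟩
      simp at this ⊢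
      nlinarith
  rcases Nat.even_or_odd' B with ⟨k, rfl | rfl⟩
  · rw [show 2 * k / 2 = k by omega, h]; exact le_of_eq (by ring)
  · rw [show (2 * k + 1) / 2 = k by omega, Finset.sum_range_succ, h]
    rw [show 2 * k - k = k by omega, show k - 2 * k = 0 by omega]; nlinarith

open Real in
theorem log_interpolation_inequality {r u v n G p m A B σ : ℕ} (hp : 2 ≤ p) (hr : 2 ≤ r)
    (hu : 0 < u) (hv : 0 < v) (hur : u ≤ r) (hvr : v ≤ r) (hm : 1 ≤ m) (hG : 0 < G)
    (hrG : (p : ℤ) ∣ (r : ℤ) ^ G - 1) (hcong : (p : ℤ) ^ m ∣ (r : ℤ) ^ n * v + u)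
    (hn : G * σ ≤ n) (hD : A * B ≤ m) (hσ : A * B ≤ G * (σ * σ)) (hA : 0 < A) (hB : 0 < B) :
    (B - 1) * log p ≤ 2 * log (A * B) / A + (log ((n * σ + σ + B : ℕ) / A) + 3 / 2)
      + B / 2 * (G * (2 * σ + B) * log r / A) := by
  have h0 := interpolation_inequality (by omega) hr hu hv hur hvr hm hG hrG hcong hn hD hσ hA (B / 2)
  set W := n * σ + σ + B with hW
  set Q := ∑ b ∈ Finset.range B, ((b - B / 2) + (B / 2 - b)) with hQ
  have hA' : (1 : ℝ) ≤ A := by exact_mod_cast hA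
  have hB' : (1 : ℝ) ≤ B := by exact_mod_cast hB
  have hAW : A ≤ W := by nlinarith
  have hlr : 0 < log r := Real.log_pos (by exact_mod_cast hr)
  have hch : ∀ a ∈ Finset.range A, W.choose a ≠ 0 := fun a ha =>
    (Nat.choose_pos ((Finset.mem_range.mp ha).le.trans hAW)).ne'
  have hp0 : (p : ℝ) ≠ 0 := by positivity
  have hr0 : (r : ℝ) ≠ 0 := by positivity
  have hpr : (∏ a ∈ Finset.range A, (W.choose a : ℝ)) ≠ 0 :=
    Finset.prod_ne_zero_iff.mpr fun a ha => by exact_mod_cast hch a ha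
  have h1 : ((p ^ (∑ j ∈ Finset.range (A * B), j) : ℕ) : ℝ) ≤ _ := Nat.cast_le.mpr h0
  have h2 := Real.log_le_log (by positivity) h1
  have hf : ((A * B).factorial : ℝ) ≠ 0 := by exact_mod_cast Nat.factorial_ne_zero _
  push_cast at h2
  rw [Real.log_mul (by positivity) (by positivity), Real.log_mul hf (by positivity),
    Real.log_mul (by positivity) (by positivity), Real.log_pow, Real.log_pow, Real.log_pow,
    Real.log_pow, Real.log_pow, Real.log_prod (by exact_mod_cast hch)] at h2
  have hgauss : ∀ N : ℕ, 0 < N → ((∑ j ∈ Finset.range N, j : ℕ) : ℝ) = N * (N - 1) / 2 := by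
    intro N hN
    rw [Finset.sum_range_id, Nat.cast_div (Nat.two_dvd_mul_sub_one N) two_ne_zero, Nat.cast_mul,
      Nat.cast_sub hN]; push_cast; ring
  have e1 := hgauss (A * B) (by positivity)
  have e2 := hgauss A hA
  push_cast at e1 e2 h2
  rw [e1, e2] at h2
  have b1 : log ((A * B).factorial : ℝ) ≤ A * B * log (A * B) := by
    have : ((A * B).factorial : ℝ) ≤ ((A * B : ℕ) : ℝ) ^ (A * B) := by
      exact_mod_cast Nat.factorial_le_pow _
    have := Real.log_le_log (by positivity) this
    rw [Real.log_pow] at this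
    push_cast at this
    exact this
  have b2 := sum_log_choose_le hA hAW
  have b3 : (4 : ℝ) * Q ≤ B ^ 2 := by exact_mod_cast four_mul_sum_dist_le B
  have b4 : 0 ≤ log ((W : ℝ) / A) := Real.log_nonneg (by
    rw [le_div_iff₀ (by positivity), one_mul]; exact_mod_cast hAW)
  have b5 : ((σ + B - 1 : ℕ) : ℝ) ≤ σ + B := by
    have : σ + B - 1 ≤ σ + B := by omega
    exact_mod_cast this
  have b6 : (A : ℝ) * Q * ((G * (σ + B - 1 : ℕ) + G * σ) * log r)
      ≤ A * (B ^ 2 / 4) * (G * (2 * σ + B) * log r) := by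
    have : (G : ℝ) * (σ + B - 1 : ℕ) + G * σ ≤ G * (2 * σ + B) := by
      nlinarith [(Nat.cast_nonneg G : (0 : ℝ) ≤ G)]
    gcongr
    linarith
  have b7 : (A * (A - 1) / 2 : ℝ) * (log ((W : ℝ) / A) + 3 / 2)
      ≤ (A * A / 2) * (log ((W : ℝ) / A) + 3 / 2) := by
    have : (A * (A - 1) / 2 : ℝ) ≤ A * A / 2 := by nlinarith
    gcongr
  have b8 : (B : ℝ) * ∑ a ∈ Finset.range A, log (W.choose a)
      ≤ B * ((A * A / 2) * (log ((W : ℝ) / A) + 3 / 2)) :=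
    mul_le_mul_of_nonneg_left (b2.trans b7) (by positivity)
  have hfin : (A * A * B / 2 : ℝ) * ((B - 1) * log p) ≤ (A * A * B / 2 : ℝ) *
      (2 * log (A * B) / A + (log ((W : ℝ) / A) + 3 / 2) + B / 2 * (G * (2 * σ + B) * log r / A)) := by
    have e3 : (A * A * B / 2 : ℝ) *
      (2 * log (A * B) / A + (log ((W : ℝ) / A) + 3 / 2) + B / 2 * (G * (2 * σ + B) * log r / A))
      = A * B * log (A * B) + B * ((A * A / 2) * (log ((W : ℝ) / A) + 3 / 2))
        + A * (B ^ 2 / 4) * (G * (2 * σ + B) * log r) := by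
      field_simp; ring
    rw [e3]
    linarith
  exact le_of_mul_le_mul_left hfin (by positivity)

open Real in
theorem cond_mono {c : ℝ} {B₀ B : ℕ} (hB₀ : 4 ≤ B₀) (hB : B₀ ≤ B)
    (h : log (14.5 * (B₀ * (B₀ + 1))) + 0.39 ≤ c * (B₀ / 2 - 1)) :
    log (14.5 * (B * (B + 1))) + 0.39 ≤ c * (B / 2 - 1) := by
  induction B, hB using Nat.le_induction with
  | base => exact h
  | succ B hB ih =>
    have hB4 : (4 : ℝ) ≤ B := by exact_mod_cast hB₀.trans hB
    have h1 : (4 : ℝ) ≤ log (14.5 * (B * (B + 1))) := by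
      rw [Real.le_log_iff_exp_le (by positivity)]
      have h2 : Real.exp 4 ≤ 2.7182818286 ^ 4 := by
        rw [show (4 : ℝ) = ((4 : ℕ) : ℝ) * 1 by norm_num, Real.exp_nat_mul]
        gcongr
        exact Real.exp_one_lt_d9.le
      refine h2.trans ?_
      nlinarith
    have h3 : 8 ≤ c * B := by nlinarith
    have h4 : log (14.5 * ((B + 1 : ℝ) * (B + 1 + 1))) ≤ log (14.5 * (B * (B + 1))) + 2 / B := by
      have h5 := Real.log_le_sub_one_of_pos
        (x := 14.5 * ((B + 1 : ℝ) * (B + 1 + 1)) / (14.5 * (B * (B + 1)))) (by positivity)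
      rw [Real.log_div (by positivity) (by positivity)] at h5
      have h6 : 14.5 * ((B + 1 : ℝ) * (B + 1 + 1)) / (14.5 * (B * (B + 1))) - 1 = 2 / B := by
        field_simp; ring
      linarith
    have h7 : 2 / (B : ℝ) ≤ c / 2 := by
      rw [div_le_iff₀ (by positivity)]; linarith
    push_cast
    linarith

open Real in
theorem two_mul_log_mul_div_le {A B : ℝ} (hA : 24.25 ≤ A) (hB : 0 < B) (hBA : B ≤ A / 6) :
    2 * log (A * B) / A ≤ 0.384 := by
  have h1 : log (A * B) ≤ 2 * log A - log 6 := by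
    have : log (A * B) ≤ log (A ^ 2 / 6) := Real.log_le_log (by positivity) (by nlinarith)
    rwa [Real.log_div (by positivity) (by norm_num), Real.log_pow, Nat.cast_ofNat] at this
  have h2 : log A ≤ log 24 + (A / 24 - 1) := by
    have := Real.log_le_sub_one_of_pos (x := A / 24) (by positivity)
    rw [Real.log_div (by positivity) (by norm_num)] at this
    linarith
  have h3 : 2 * log 24 - log 6 ≤ 4.58 := by
    have h4 : (5 : ℝ) * (2 * log 24 - log 6) ≤ 33 * log 2 := by
      have := Real.log_le_log (x := 96 ^ 5) (y := 2 ^ 33) (by norm_num) (by norm_num)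
      rw [Real.log_pow, Real.log_pow, show (96 : ℝ) = 24 ^ 2 / 6 by norm_num,
        Real.log_div (by norm_num) (by norm_num), Real.log_pow] at this
      exact_mod_cast this
    have := Real.log_two_lt_d9
    linarith
  rw [div_le_iff₀ (by linarith)]
  linarith

open Real in
theorem log_add_le_of_le {x y : ℝ} (hx : 0 < x) (hxy : x ≤ 3.225 * y) :
    log x + 3 / 2 ≤ log (14.5 * y) := by
  have hy : 0 < y := by nlinarith
  have h1 : (3 / 2 : ℝ) ≤ log 4.496 := by
    have h2 : (3 : ℝ) ≤ log (4.496 ^ 2) := by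
      rw [Real.le_log_iff_exp_le (by positivity)]
      have h2 : Real.exp 3 ≤ 2.7182818286 ^ 3 := by
        rw [show (3 : ℝ) = ((3 : ℕ) : ℝ) * 1 by norm_num, Real.exp_nat_mul]
        gcongr
        exact Real.exp_one_lt_d9.le
      exact h2.trans (by norm_num)
    rw [Real.log_pow] at h2
    push_cast at h2
    linarith
  have h3 : log x ≤ log (3.225 * y) := Real.log_le_log hx hxy
  have h4 : log (4.496 * (3.225 * y)) ≤ log (14.5 * y) := Real.log_le_log (by positivity) (by linarith)
  rw [Real.log_mul (by norm_num) (by positivity)] at h4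
  linarith

open Real in
theorem parameter_contradiction {P L σ B a G l m : ℝ} (hP : 0 < P) (hL : 0 < L) (hσ10 : 10 ≤ σ)
    (hB4 : 4 ≤ B) (hG' : 1 ≤ G) (hB1 : B * L ≤ 0.4 * (σ * P)) (hB2 : 0.4 * (σ * P) ≤ (B + 1) * L)
    (hBσ : B ≤ 0.4 * σ) (ha2 : 0.97 * (σ * σ) ≤ a * B) (ha3 : 2.425 * σ ≤ a)
    (hl : l * L ≤ m * P) (hl0 : 0 ≤ l) (hm : m ≤ G * ((σ + 1) * (σ + 1)))
    (hcond : log (14.5 * (B * (B + 1))) + 0.39 ≤ P * (B / 2 - 1))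
    (hmain : (B - 1) * P ≤ 2 * log (G * a * B) / (G * a)
      + (log (((l + 1) * σ + σ + B) / (G * a)) + 3 / 2) + B / 2 * (G * (2 * σ + B) * L / (G * a))) :
    False := by
  have hσ0 : 0 < σ := by linarith
  have hB0 : 0 < B := by linarith
  have hG0 : 0 < G := by linarith
  have ha0 : 0 < a := by linarith
  have haA : a ≤ G * a := le_mul_of_one_le_left ha0.le hG'
  have c1 : 2 * log (G * a * B) / (G * a) ≤ 0.384 :=
    two_mul_log_mul_div_le (by linarith) hB0 (by linarith)
  have c2 : B / 2 * (G * (2 * σ + B) * L / (G * a)) ≤ 0.5 * B * P := by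
    have h1 : G * (2 * σ + B) * L / (G * a) ≤ P := by
      rw [div_le_iff₀ (by positivity)]
      have h2 : (2 * σ + B) * L ≤ P * a := by
        refine le_of_mul_le_mul_right ?_ hB0
        calc (2 * σ + B) * L * B = (2 * σ + B) * (B * L) := by ring
          _ ≤ (2.4 * σ) * (0.4 * (σ * P)) := mul_le_mul (by linarith) hB1 (by positivity) (by positivity)
          _ = P * (0.96 * (σ * σ)) := by ring
          _ ≤ P * (a * B) := mul_le_mul_of_nonneg_left
              (le_trans (mul_le_mul_of_nonneg_right (by norm_num) (by positivity)) ha2) hP.le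
          _ = _ := by ring
      calc G * (2 * σ + B) * L = G * ((2 * σ + B) * L) := by ring
        _ ≤ G * (P * a) := mul_le_mul_of_nonneg_left h2 hG0.le
        _ = _ := by ring
    calc _ ≤ B / 2 * P := mul_le_mul_of_nonneg_left h1 (by positivity)
      _ = _ := by ring
  have c3 : ((l + 1) * σ + σ + B) / (G * a) ≤ 3.225 * (B * (B + 1)) := by
    rw [div_le_iff₀ (by positivity)]
    have h0 : (σ + 1) * (σ + 1) ≤ (1.1 * σ) * (1.1 * σ) :=
      mul_le_mul (by linarith) (by linarith) (by linarith) (by linarith)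
    have h1 : l * σ ≤ 3.025 * ((B + 1) * G * (σ * σ)) := by
      refine le_of_mul_le_mul_right ?_ hL
      calc l * σ * L = (l * L) * σ := by ring
        _ ≤ (m * P) * σ := mul_le_mul_of_nonneg_right hl hσ0.le
        _ ≤ (G * ((1.1 * σ) * (1.1 * σ)) * P) * σ := by
          gcongr
          exact hm.trans (mul_le_mul_of_nonneg_left h0 hG0.le)
        _ = 3.025 * G * (σ * σ) * (0.4 * (σ * P)) := by ring
        _ ≤ 3.025 * G * (σ * σ) * ((B + 1) * L) := mul_le_mul_of_nonneg_left hB2 (by positivity)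
        _ = _ := by ring
    have h2 : 2 * σ + B ≤ 0.1 * ((B + 1) * G * (σ * σ)) := by
      have : (5 : ℝ) * 1 * (10 * σ) ≤ (B + 1) * G * (σ * σ) := by
        refine mul_le_mul (mul_le_mul (by linarith) hG' (by norm_num) (by linarith)) ?_ (by positivity)
          (by positivity)
        exact mul_le_mul_of_nonneg_right hσ10 hσ0.le
      linarith
    have h3 : (B + 1) * G * (0.97 * (σ * σ)) ≤ (B + 1) * G * (a * B) :=
      mul_le_mul_of_nonneg_left ha2 (by positivity)
    have h4 : 0 ≤ (B + 1) * G * (σ * σ) := by positivity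
    have h5 : 3.225 * (B * (B + 1)) * (G * a) = 3.225 * ((B + 1) * G * (a * B)) := by ring
    have h6 : (B + 1) * G * (0.97 * (σ * σ)) = 0.97 * ((B + 1) * G * (σ * σ)) := by ring
    have h7 : (l + 1) * σ + σ + B = l * σ + (2 * σ + B) := by ring
    rw [h5, h7]
    rw [h6] at h3
    linarith
  have c4 := log_add_le_of_le (by positivity) c3
  linarith

open Real in
/-- An effective bound for the exponent `l`, from interpolation determinants. -/
theorem exponent_bound {p r u v G l m B₀ : ℕ} (hp : 2 ≤ p) (hpr : p ≤ r) (hu : 0 < u) (hv : 0 < v)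
    (hur : u ≤ r) (hvr : v ≤ r) (hm : 1 ≤ m) (hG : 0 < G)
    (hrG : (p : ℤ) ∣ (r : ℤ) ^ G - 1) (hcong : (p : ℤ) ^ m ∣ (r : ℤ) ^ (l + 1) * v + u)
    (hl : r ^ l ≤ p ^ m) (hn : p ^ m ≤ r ^ (l + 1)) (hB₀ : 4 ≤ B₀)
    (hcond : log (14.5 * (B₀ * (B₀ + 1))) + 0.39 ≤ log p * (B₀ / 2 - 1)) :
    l * log p ≤ (2.5 * B₀ + 1) ^ 2 * G * log r := by
  have hp' : (0 : ℝ) < p := by positivity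
  have hr' : (0 : ℝ) < r := by
    have : 0 < r := by omega
    exact_mod_cast this
  have hlp : 0 < log p := Real.log_pos (by exact_mod_cast hp)
  have hlpr : log p ≤ log r := Real.log_le_log hp' (by exact_mod_cast hpr)
  have hlr : 0 < log r := hlp.trans_le hlpr
  have hl' : l * log r ≤ m * log p := by
    rw [← Real.log_pow, ← Real.log_pow]
    exact Real.log_le_log (by positivity) (by exact_mod_cast hl)
  have hn' : m * log p ≤ (l + 1) * log r := by
    have := Real.log_le_log (by positivity) (show (p : ℝ) ^ m ≤ (r : ℝ) ^ (l + 1) by exact_mod_cast hn)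
    rw [Real.log_pow, Real.log_pow] at this
    exact_mod_cast this
  set σ := Nat.sqrt (m / G) with hσ
  have hσ1 : G * (σ * σ) ≤ m :=
    (Nat.mul_le_mul_left _ (Nat.sqrt_le _)).trans (Nat.mul_div_le _ _)
  have hσ2 : m < G * ((σ + 1) * (σ + 1)) := by
    have h1 : m / G < (σ + 1) * (σ + 1) := Nat.lt_succ_sqrt _
    rw [Nat.div_lt_iff_lt_mul hG] at h1
    rwa [mul_comm]
  have hG' : (1 : ℝ) ≤ G := by exact_mod_cast hG
  have hσ2' : (m : ℝ) ≤ G * ((σ + 1) * (σ + 1)) := by exact_mod_cast hσ2.le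
  have hσ1' : (G : ℝ) * (σ * σ) ≤ m := by exact_mod_cast hσ1
  have hB₀' : (4 : ℝ) ≤ B₀ := by exact_mod_cast hB₀
  have hσ0 : (0 : ℝ) ≤ σ := Nat.cast_nonneg _
  rcases lt_or_ge (σ * log p) (2.5 * B₀ * log r) with hθ | hθ
  · refine le_of_mul_le_mul_right ?_ hlr
    calc l * log p * log r = l * log r * log p := by ring
      _ ≤ G * ((σ + 1) * (σ + 1)) * log p * log p := by
        exact mul_le_mul_of_nonneg_right (hl'.trans (by gcongr)) hlp.le
      _ = G * (σ * log p + log p) ^ 2 := by ring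
      _ ≤ G * (2.5 * B₀ * log r + log r) ^ 2 := by gcongr
      _ = _ := by ring
  exfalso
  set B := ⌊0.4 * (σ * log p / log r)⌋₊ with hB
  have hB1 : (B : ℝ) * log r ≤ 0.4 * (σ * log p) := by
    have := Nat.floor_le (a := 0.4 * (σ * log p / log r)) (by positivity)
    rw [← hB, ← mul_div_assoc, le_div_iff₀ hlr] at this
    exact this
  have hB2 : 0.4 * (σ * log p) ≤ (B + 1) * log r := by
    have := (Nat.lt_floor_add_one (0.4 * (σ * log p / log r))).le
    rwa [← hB, ← mul_div_assoc, div_le_iff₀ hlr] at this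
  have hBB₀ : B₀ ≤ B := by
    refine Nat.le_floor ?_
    rw [← mul_div_assoc, le_div_iff₀ hlr]
    linarith
  have hB4 : (4 : ℝ) ≤ B := hB₀'.trans (by exact_mod_cast hBB₀)
  have hBσ : (B : ℝ) ≤ 0.4 * σ := by
    refine le_of_mul_le_mul_right (hB1.trans ?_) hlr
    rw [mul_assoc]
    gcongr
  have hσ10 : (10 : ℝ) ≤ σ := by linarith
  have hBpos : 0 < B := by
    have : (0 : ℝ) < B := by linarith
    exact_mod_cast this
  set a := σ * σ / B with ha
  have ha1 : a * B ≤ σ * σ := Nat.div_mul_le_self _ _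
  have ha2 : (0.97 : ℝ) * (σ * σ) ≤ a * B := by
    have h1 : σ * σ < (a + 1) * B := by
      rw [← Nat.div_lt_iff_lt_mul hBpos]; exact Nat.lt_succ_self _
    have h2 : (σ * σ + 1 : ℝ) ≤ (a + 1) * B := by exact_mod_cast h1
    nlinarith
  have ha3 : (2.425 : ℝ) * σ ≤ a := by
    have h1 : (a : ℝ) * B ≤ a * (0.4 * σ) := by gcongr
    have : (2.425 * σ : ℝ) * σ ≤ a * σ := by linarith
    exact le_of_mul_le_mul_right this (by linarith)
  have hapos : 0 < a := by
    have : (0 : ℝ) < a := by linarith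
    exact_mod_cast this
  have hAB : G * a * B ≤ G * (σ * σ) := by rw [mul_assoc]; exact Nat.mul_le_mul_left _ ha1
  have hnσ : G * σ ≤ l + 1 := by
    have h1 : (G * σ : ℝ) * log r ≤ (l + 1) * log r := by
      refine le_trans ?_ hn'
      calc (G * σ : ℝ) * log r ≤ G * σ * (2.5 * B₀ * log r) := by
            have : 1 * log r ≤ 2.5 * B₀ * log r := by gcongr; linarith
            rw [one_mul] at this
            gcongr
        _ ≤ G * σ * (σ * log p) := by gcongr
        _ = G * (σ * σ) * log p := by ring
        _ ≤ _ := by gcongr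
    have := le_of_mul_le_mul_right h1 hlr
    exact_mod_cast this
  have hmain := log_interpolation_inequality hp (hp.trans hpr) hu hv hur hvr hm hG hrG hcong hnσ
    (hAB.trans hσ1) hAB (Nat.mul_pos hG hapos) hBpos
  have hA : ((G * a : ℕ) : ℝ) = G * a := by push_cast; ring
  rw [hA] at hmain
  push_cast at hmain
  exact parameter_contradiction hlp hlr hσ10 hB4 hG' hB1 hB2 hBσ ha2 ha3 hl' (Nat.cast_nonneg l)
    hσ2' (cond_mono hB₀ hBB₀ hcond) hmain

theorem repunit_identity {p r m n : ℕ}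
    (h : ∑ i ∈ Finset.range m, p ^ i = ∑ i ∈ Finset.range n, r ^ i) :
    (p : ℤ) ^ m * (r - 1) = (r : ℤ) ^ n * (p - 1) + (r - p) := by
  have h1 := geom_sum_mul (p : ℤ) m
  have h2 := geom_sum_mul (r : ℤ) n
  have h3 : ∑ i ∈ Finset.range m, (p : ℤ) ^ i = ∑ i ∈ Finset.range n, (r : ℤ) ^ i := by
    exact_mod_cast h
  rw [h3] at h1
  linear_combination (1 - (r : ℤ)) * h1 + ((p : ℤ) - 1) * h2

theorem pow_lt_pow_of_repunit_eq {p r m l : ℕ} (hp : 2 ≤ p)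
    (h : ∑ i ∈ Finset.range m, p ^ i = ∑ i ∈ Finset.range (l + 1), r ^ i) :
    r ^ l < p ^ m := by
  have h1 : r ^ l ≤ ∑ i ∈ Finset.range (l + 1), r ^ i :=
    Finset.single_le_sum (f := fun i => r ^ i) (fun _ _ => Nat.zero_le _) (by simp)
  have h2 := Nat.geomSum_lt (m := p) (n := m) (s := Finset.range m) hp (by simp)
  omega

theorem pow_le_pow_of_repunit_eq {p r m n : ℕ} (hpr : p ≤ r)
    (h : ∑ i ∈ Finset.range m, p ^ i = ∑ i ∈ Finset.range n, r ^ i) :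
    p ^ m ≤ r ^ n := by
  have h1 := geom_sum_mul (p : ℤ) m
  have h2 := geom_sum_mul (r : ℤ) n
  have h3 : ∑ i ∈ Finset.range m, (p : ℤ) ^ i = ∑ i ∈ Finset.range n, (r : ℤ) ^ i := by
    exact_mod_cast h
  have h4 : 0 ≤ ∑ i ∈ Finset.range n, (r : ℤ) ^ i := by positivity
  have h5 : (p : ℤ) ≤ r := by exact_mod_cast hpr
  rw [h3] at h1
  have : (p : ℤ) ^ m ≤ (r : ℤ) ^ n := by nlinarith
  exact_mod_cast this

theorem repunit_cast_eq_one {p m : ℕ} (hm : 1 ≤ m) :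
    ((∑ i ∈ Finset.range m, p ^ i : ℕ) : ZMod p) = 1 := by
  obtain ⟨k, rfl⟩ := Nat.exists_eq_add_of_le' hm
  rw [Finset.sum_range_succ']
  simp [pow_succ]

theorem zmod_pow_eq_one {p r m l : ℕ} (hp : p.Prime) (hr : r.Prime) (hne : p ≠ r) (hm : 1 ≤ m)
    (h : ∑ i ∈ Finset.range m, p ^ i = ∑ i ∈ Finset.range (l + 1), r ^ i) :
    (r : ZMod p) ^ l = 1 := by
  have := Fact.mk hp
  have h1 := repunit_cast_eq_one (p := p) hm
  rw [h, Finset.sum_range_succ'] at h1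
  push_cast at h1
  have h2 : (r : ZMod p) * ∑ i ∈ Finset.range l, (r : ZMod p) ^ i = 0 := by
    rw [Finset.mul_sum]
    have : ∀ i, (r : ZMod p) * (r : ZMod p) ^ i = (r : ZMod p) ^ (i + 1) := fun i => by ring
    simp only [this]
    simpa using h1
  have hr0 : (r : ZMod p) ≠ 0 := by
    rw [Ne, ZMod.natCast_eq_zero_iff]
    exact fun hd => hne ((Nat.prime_dvd_prime_iff_eq hp hr).1 hd)
  have h3 := (mul_eq_zero.1 h2).resolve_left hr0
  have h4 := geom_sum_mul (r : ZMod p) l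
  rw [h3, zero_mul] at h4
  exact (sub_eq_zero.1 h4.symm)

theorem pow_exponent_le {r s k l : ℕ} (hs : 1 ≤ s) (hsr : s ≤ r)
    (h : ∑ i ∈ Finset.range (k + 1), s ^ i = ∑ i ∈ Finset.range (l + 1), r ^ i) :
    s ^ k ≤ r ^ l := by
  have h1 := geom_sum_mul (s : ℤ) (k + 1)
  have h2 := geom_sum_mul (r : ℤ) (l + 1)
  have h3 : ∑ i ∈ Finset.range (k + 1), (s : ℤ) ^ i = ∑ i ∈ Finset.range (l + 1), (r : ℤ) ^ i := by
    exact_mod_cast h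
  rw [h3] at h1
  have h4 : 1 ≤ ∑ i ∈ Finset.range (l + 1), (r : ℤ) ^ i := by
    rw [Finset.sum_range_succ']
    have : 0 ≤ ∑ i ∈ Finset.range l, (r : ℤ) ^ (i + 1) := by positivity
    simp only [pow_zero]; linarith
  set S := ∑ i ∈ Finset.range (l + 1), (r : ℤ) ^ i
  have h5 : (s : ℤ) ≤ r := by exact_mod_cast hsr
  have h6 : (1 : ℤ) ≤ s := by exact_mod_cast hs
  have h7 : (s : ℤ) ^ k * (s * r) ≤ (r : ℤ) ^ l * (s * r) := by
    have e1 : (s : ℤ) ^ k * (s * r) = (S * (s - 1) + 1) * r := by rw [h1]; ring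
    have e2 : (r : ℤ) ^ l * (s * r) = (S * (r - 1) + 1) * s := by rw [h2]; ring
    rw [e1, e2]; nlinarith
  have h8 : (s : ℤ) ^ k ≤ (r : ℤ) ^ l := le_of_mul_le_mul_right h7 (by nlinarith)
  exact_mod_cast h8

open Real in
/-- The exponent bound for a pair of prime solutions `p < r` of the same repunit equation. -/
theorem repunit_exponent_bound {p r m l G B₀ : ℕ} (hp : p.Prime) (hpr : p < r)
    (hm : 1 ≤ m) (hG : 0 < G) (hrG : (r : ZMod p) ^ G = 1)
    (h : ∑ i ∈ Finset.range m, p ^ i = ∑ i ∈ Finset.range (l + 1), r ^ i) (hB₀ : 4 ≤ B₀)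
    (hcond : log (14.5 * (B₀ * (B₀ + 1))) + 0.39 ≤ log p * (B₀ / 2 - 1)) :
    l * log p ≤ (2.5 * B₀ + 1) ^ 2 * G * log r := by
  have h2 := hp.two_le
  refine exponent_bound (p := p) (r := r) (u := r - p) (v := p - 1) (m := m) h2 hpr.le (by omega)
    (by omega) (by omega) (by omega) hm hG ?_ ?_ (pow_lt_pow_of_repunit_eq h2 h).le
    (pow_le_pow_of_repunit_eq hpr.le h) hB₀ hcond
  · rw [← ZMod.intCast_zmod_eq_zero_iff_dvd]
    simp [hrG]
  · refine ⟨(r : ℤ) - 1, ?_⟩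
    rw [repunit_identity h]
    push_cast [Nat.cast_sub hpr.le, Nat.cast_sub (show 1 ≤ p by omega)]
    ring

open Real in
/-- If `r ↦ l r` is injective on a finite set with smallest element `s`, and the powers `r ^ l r`
are at least `s ^ l s`, the reciprocals decay geometrically. -/
theorem sum_inv_le_of_injOn (T : Finset ℕ) (l : ℕ → ℕ) (s : ℕ) (hs2 : 2 ≤ s)
    (hl0 : ∀ r ∈ T, 1 ≤ l r) (hinj : Set.InjOn l T) (hls : 1 ≤ l s) (hle : ∀ r ∈ T, l r ≤ l s)
    (hpow : ∀ r ∈ T, s ^ l s ≤ r ^ l r) (hT0 : ∀ r ∈ T, 1 ≤ r) :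
    ∑ r ∈ T, (1 : ℝ) / r ≤ 1 / s * (1 + l s / log s) := by
  have hs1 : (1 : ℝ) < s := by exact_mod_cast hs2
  have hlog : 0 < log s := log_pos hs1
  have hls' : (0 : ℝ) < l s := by exact_mod_cast hls
  set t : ℝ := log s / l s with ht
  have htpos : 0 < t := by positivity
  set x : ℝ := exp (-t) with hx
  have hx0 : 0 ≤ x := (exp_pos _).le
  have hx1 : x < 1 := by rw [hx, exp_lt_one_iff]; linarith
  have key : ∀ r ∈ T, (1 : ℝ) / r ≤ 1 / s * x ^ (l s - l r) := by
    intro r hr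
    have hr0 : (0 : ℝ) < r := by exact_mod_cast hT0 r hr
    have hlr : (0 : ℝ) < l r := by exact_mod_cast hl0 r hr
    have hlr2 : (l r : ℝ) ≤ l s := by exact_mod_cast hle r hr
    have h1 : (l s : ℝ) * log s ≤ l r * log r := by
      have := hpow r hr
      have h2 : ((s : ℝ)) ^ l s ≤ (r : ℝ) ^ l r := by exact_mod_cast this
      have h3 := log_le_log (by positivity) h2
      rwa [log_pow, log_pow] at h3
    have h2 : log s + ((l s : ℝ) - l r) * t ≤ log r := by
      have h3 : (log s + ((l s : ℝ) - l r) * t) * l r ≤ log s * l s := by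
        have e : log s = t * l s := by rw [ht]; field_simp
        rw [e]
        have : 0 ≤ t * ((l s : ℝ) - l r) ^ 2 := by positivity
        nlinarith
      nlinarith
    have h4 : (1 : ℝ) / r = exp (-log r) := by rw [exp_neg, exp_log hr0, one_div]
    have h5 : (1 : ℝ) / s = exp (-log s) := by rw [exp_neg, exp_log (by linarith), one_div]
    rw [h4, h5, hx, ← exp_nat_mul, ← exp_add, Nat.cast_sub (hle r hr)]
    apply exp_le_exp.2
    linarith
  have hgeo : ∑ r ∈ T, x ^ (l s - l r) ≤ 1 + 1 / t := by
    have hinj2 : Set.InjOn (fun r => l s - l r) T := by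
      intro a ha b hb hab
      apply hinj ha hb
      have := hle a ha; have := hle b hb
      simp only at hab; omega
    rw [← Finset.sum_image (f := fun j => x ^ j) hinj2]
    have h1 := Summable.sum_le_tsum (f := fun j : ℕ => x ^ j)
      (T.image (fun r => l s - l r)) (fun _ _ => by positivity) (summable_geometric_of_lt_one hx0 hx1)
    rw [tsum_geometric_of_lt_one hx0 hx1] at h1
    refine h1.trans ?_
    rw [inv_le_iff_one_le_mul₀ (by linarith)]
    have h2 : x * (1 + t) ≤ 1 := by
      have := add_one_le_exp t
      calc x * (1 + t) ≤ x * exp t := by gcongr; linarith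
        _ = 1 := by rw [hx, ← exp_add]; simp
    have h3 : (1 + 1 / t) * (1 - x) = (1 + t - x * (1 + t)) / t := by
      field_simp
      ring
    rw [h3, le_div_iff₀ htpos]; linarith
  calc ∑ r ∈ T, (1 : ℝ) / r ≤ ∑ r ∈ T, 1 / s * x ^ (l s - l r) := Finset.sum_le_sum key
    _ = 1 / s * ∑ r ∈ T, x ^ (l s - l r) := by rw [Finset.mul_sum]
    _ ≤ 1 / s * (1 + 1 / t) := by gcongr
    _ = _ := by rw [ht]; field_simp

open Real in
/-- The total bound: each possible order of `r` modulo `p` contributes a geometric-type sum. -/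
theorem sum_inv_solutions_le {N p m R B₀ : ℕ} (S : Finset ℕ) (hp : p.Prime) (hp0 : IsNSol N p m)
    (hS : ∀ r ∈ S, p < r ∧ r.Prime ∧ ∃ n, IsNSol N r n) (hR : 1 ≤ R) (hSR : ∀ r ∈ S, R ≤ r)
    (hB₀ : 4 ≤ B₀) (hcond : log (14.5 * (B₀ * (B₀ + 1))) + 0.39 ≤ log p * (B₀ / 2 - 1)) :
    ∑ r ∈ S, (1 : ℝ) / r ≤
      (p - 1).divisors.card * (1 / R * (1 + (2.5 * B₀ + 1) ^ 2 / log p)) := by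
  classical
  have hfact := Fact.mk hp
  have hp2 := hp.two_le
  have hlogp : 0 < log p := log_pos (by exact_mod_cast hp2)
  obtain ⟨_, hm, hNp⟩ := hp0
  have hex : ∀ r : ℕ, ∃ l : ℕ, r ∈ S → 1 ≤ l ∧ ∑ i ∈ Finset.range (l + 1), r ^ i = N := by
    intro r
    by_cases hr : r ∈ S
    · obtain ⟨_, _, n, _, hn, hN⟩ := hS r hr
      refine ⟨n - 1, fun _ => ⟨by omega, ?_⟩⟩
      rw [Nat.sub_add_cancel (by omega)]; exact hN
    · exact ⟨0, fun h => absurd h hr⟩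
  choose l hl using hex
  have hone : ∀ r ∈ S, (r : ZMod p) ^ l r = 1 := fun r hr =>
    zmod_pow_eq_one hp (hS r hr).2.1 (hS r hr).1.ne (by omega : 1 ≤ m)
      (hNp.trans (hl r hr).2.symm)
  have hr0 : ∀ r ∈ S, (r : ZMod p) ≠ 0 := by
    intro r hr h0
    have := hone r hr
    rw [h0, zero_pow (by have := (hl r hr).1; omega)] at this
    exact zero_ne_one this
  have hmaps : ∀ r ∈ S, orderOf (r : ZMod p) ∈ (p - 1).divisors := by
    intro r hr
    rw [Nat.mem_divisors]
    exact ⟨ZMod.orderOf_dvd_card_sub_one (hr0 r hr), by omega⟩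
  rw [← Finset.sum_fiberwise_of_maps_to hmaps, ← nsmul_eq_mul]
  apply Finset.sum_le_card_nsmul
  intro g hg
  set T := S.filter (fun r : ℕ => orderOf (r : ZMod p) = g) with hT
  have hTS : ∀ r ∈ T, r ∈ S := fun r hr => (Finset.mem_filter.1 hr).1
  have hg0 : 0 < g := Nat.pos_of_mem_divisors hg
  rcases T.eq_empty_or_nonempty with he | hne
  · rw [he, Finset.sum_empty]; positivity
  have hgl : ∀ r ∈ T, ∃ k, l r = g * k := by
    intro r hr
    have := orderOf_dvd_of_pow_eq_one (hone r (hTS r hr))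
    rwa [(Finset.mem_filter.1 hr).2] at this
  set s := T.min' hne with hs
  have hsT : s ∈ T := T.min'_mem hne
  have hsS := hTS s hsT
  have hsp := (hS s hsS).1
  have hmin : ∀ r ∈ T, s ≤ r := fun r hr => T.min'_le r hr
  have hpw : ∀ r ∈ T, s ^ l s ≤ r ^ l r := fun r hr =>
    pow_exponent_le (by omega) (hmin r hr) ((hl s hsS).2.trans (hl r (hTS r hr)).2.symm)
  have hanti : ∀ a ∈ S, ∀ b ∈ S, l a ≤ l b → b ≤ a := by
    intro a ha b hb hab
    by_contra! hlt
    have h1 := (hl a ha).2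
    have h2 := (hl b hb).2
    have h3 : ∑ i ∈ Finset.range (l a + 1), a ^ i < ∑ i ∈ Finset.range (l b + 1), b ^ i := by
      calc ∑ i ∈ Finset.range (l a + 1), a ^ i < ∑ i ∈ Finset.range (l a + 1), b ^ i := by
            apply Finset.sum_lt_sum (fun i _ => Nat.pow_le_pow_left hlt.le i)
            exact ⟨1, by simpa using by have := (hl a ha).1; omega, by simpa using hlt⟩
        _ ≤ _ := Finset.sum_le_sum_of_subset (by
            intro i; simp only [Finset.mem_range]; omega)
    omega
  have hmul : ∀ r ∈ T, g * (l r / g) = l r := fun r hr => by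
    obtain ⟨k, hk⟩ := hgl r hr
    rw [hk, Nat.mul_div_cancel_left _ hg0]
  have hdiv1 : ∀ r ∈ T, 1 ≤ l r / g := by
    intro r hr
    have h1 := hmul r hr; have h2 := (hl r (hTS r hr)).1
    by_contra! h
    have h0 : l r / g = 0 := Nat.lt_one_iff.1 h
    rw [h0] at h1; omega
  have hlle : ∀ r ∈ T, l r ≤ l s := by
    intro r hr
    by_contra! h
    have h1 := hanti s hsS r (hTS r hr) h.le
    have h2 : r = s := le_antisymm h1 (hmin r hr)
    rw [h2] at h; omega
  have hsum := sum_inv_le_of_injOn T (fun r => l r / g) s (by omega) hdiv1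
    (by
      intro a ha b hb hab
      have ha := Finset.mem_coe.1 ha; have hb := Finset.mem_coe.1 hb
      have h1 := hmul a ha; have h2 := hmul b hb
      simp only at hab
      rw [hab] at h1
      have h3 : l a = l b := h1.symm.trans h2
      exact le_antisymm (hanti b (hTS b hb) a (hTS a ha) h3.ge) (hanti a (hTS a ha) b (hTS b hb) h3.le))
    (hdiv1 s hsT) (fun r hr => Nat.div_le_div_right (hlle r hr))
    (by
      intro r hr
      have h := hpw r hr
      rw [← hmul s hsT, ← hmul r hr, mul_comm g, mul_comm g, pow_mul, pow_mul] at h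
      exact (Nat.pow_le_pow_iff_left (by omega)).1 h)
    (fun r hr => by have := hmin r hr; omega)
  refine hsum.trans ?_
  have hlogs : 0 < log s := log_pos (by exact_mod_cast (by omega : 1 < s))
  have hRs : (R : ℝ) ≤ s := by exact_mod_cast hSR s hsS
  have hR0 : (0 : ℝ) < R := by exact_mod_cast hR
  have hbd := repunit_exponent_bound hp hsp (by omega : 1 ≤ m) hg0
    (by rw [← (Finset.mem_filter.1 hsT).2]; exact pow_orderOf_eq_one _)
    (hNp.trans (hl s hsS).2.symm) hB₀ hcond
  have hg0' : (0 : ℝ) < g := by exact_mod_cast hg0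
  have hcast : ((l s : ℕ) : ℝ) = g * ((l s / g : ℕ) : ℝ) := by exact_mod_cast (hmul s hsT).symm
  have h5 : ((l s / g : ℕ) : ℝ) / log s ≤ (2.5 * B₀ + 1) ^ 2 / log p := by
    rw [div_le_div_iff₀ hlogs hlogp]
    rw [hcast] at hbd
    have : (g : ℝ) * (((l s / g : ℕ) : ℝ) * log p) ≤ g * ((2.5 * B₀ + 1) ^ 2 * log s) := by
      linarith
    exact le_of_mul_le_mul_left this hg0'
  have h6 : 0 ≤ ((l s / g : ℕ) : ℝ) / log s := by positivity
  gcongr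

namespace RepunitPairs

/-- Evaluate the first argument to a literal before passing it on. -/
def force (x : ℕ) (k : ℕ → Bool) : Bool := Nat.casesOn x (k 0) (fun n => k (n + 1))

/-- The next base-`p` digit of the discrete logarithm. -/
def nextDigit (p M a t g q : ℕ) : ℕ :=
  ((a + M - t) / q % p) * (((g - 1) / q * t) % p) ^ (p - 2) % p

/-- Compute, digit by digit, the `p`-adic discrete logarithm of `a` and test that it exceeds `L`. -/
def dlogCheck (p M a L : ℕ) (n : ℕ) : (t x g P q : ℕ) → Bool :=
  Nat.rec
    (fun t x g P q =>
      force (nextDigit p M a t g q) fun d =>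
        (g % M != 1) && (t * g ^ d % M == a % M) && Nat.blt L (x + d * P) &&
          Nat.blt (x + d * P) (P * p))
    (fun _ ih t x g P q =>
      force (nextDigit p M a t g q) fun d =>
      force (t * g ^ d % M) fun t' =>
      force (x + d * P) fun x' =>
      force (g ^ p % M) fun g' =>
      force (P * p) fun P' =>
      force (q * p) fun q' => ih t' x' g' P' q')
    n

/-- No power `p ^ m` dividing `Q` belongs to an equal repunit in base `r`. -/
def smallCheck (p r Q : ℕ) (n : ℕ) : (w : ℕ) → Bool :=
  Nat.rec (fun _ => false)
    (fun _ ih w =>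
      bif Nat.ble Q w then true else
        ((r - 1) * Q % (w * r * (p - 1) + (r - p)) != 0) && force (w * r) ih) n

/-- The largest power of `p` dividing `z`, as a power of `p` (multiplied into `q`). -/
def primePart (p z : ℕ) (n : ℕ) : (q : ℕ) → ℕ :=
  Nat.rec (fun q => q) (fun _ ih q => bif z % (q * p) == 0 then ih (q * p) else q) n

/-- Test that no repunits in bases `p < r` agree with the exponent in base `r` at most `L`. -/
def pairCheck (p r E f L : ℕ) : Bool :=
  force (r ^ E) fun z =>
  force ((r - p) ^ E) fun a =>
  force (z * (p - 1) ^ E) fun b =>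
  force (primePart p (z - 1) 40 1) fun q =>
    bif a % q == b % q then
      force (q * p ^ f) fun M =>
        smallCheck p r M M.log2 r && force (z % M) fun g => force (b % M) fun t =>
          force (a % M) fun a' => dlogCheck p M a' L (f - 1) t 0 g 1 q
    else
      (z % q == 1) && smallCheck p r q q.log2 r

/-- A superset of the primes, recognised by trial division up to `113`. -/
def isCandidate (r : ℕ) : Bool :=
  Nat.gcd r 31610054640417607788145206291543662493274686990 == 1 || (Nat.blt r 114 && List.elem r [2, 3, 5, 7, 11, 13, 17, 19, 23, 29, 31, 37, 41, 43, 47, 53, 59, 61, 67, 71, 73, 79, 83, 89, 97, 101, 103, 107, 109, 113])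

/-- Apply `pairCheck` to `n` consecutive values of `r`, omitting the genuine pair `(2, 5)`. -/
def scan (p E f L n : ℕ) : (r : ℕ) → Bool :=
  Nat.rec (fun _ => true)
    (fun _ ih r =>
      (bif isCandidate r && !(p == 2 && r == 5) then pairCheck p r E f L else true) &&
        force (r + 1) ih) n

/-- The number of divisors of `n`, counted in pairs, for `n` below `48 ^ 2`. -/
def divisorCount (n k : ℕ) : ℕ :=
  Nat.rec 0 (fun k ih =>
    ih + (bif Nat.ble ((k + 1) * (k + 1)) n && n % (k + 1) == 0 then
      (bif (k + 1) * (k + 1) == n then 1 else 2) else 0)) k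

/-- The parameter `B₀` used for the prime `p`. -/
def tier (p : ℕ) : ℕ :=
  bif Nat.ble 432 p then 4 else bif Nat.ble 79 p then 5 else bif Nat.ble 31 p then 6 else
  bif Nat.ble 19 p then 7 else bif Nat.ble 13 p then 8 else bif Nat.ble 11 p then 9 else
  bif Nat.ble 7 p then 10 else bif Nat.ble 5 p then 13 else bif Nat.ble 3 p then 19 else 31

/-- All numerical conditions for the prime `p`, with larger solutions excluded below `R`. -/
def baseCheck (p B R k E : ℕ) : Bool :=
  Nat.ble 4 B && Nat.ble ((2146 * (B * (B + 1))) ^ 2) (10 ^ 4 * p ^ (B - 2)) &&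
  (force (Nat.log2 (p ^ 16)) fun A => Nat.blt 0 A &&
    Nat.blt (divisorCount (p - 1) 47 * ((69314 * A + 400000 * (5 * B + 2) ^ 2) * 10 ^ 5))
      (73194 * 69314 * A * R)) &&
  Nat.ble R (p ^ k) &&
  force ((5 * B + 2) ^ 2 * (p - 1) * k / 4) fun L =>
  force (Nat.log2 (2 ^ 18 * L) / Nat.log2 p + 1) fun f =>
    scan p E f L (R - (p + 1)) (p + 1)

/-- `baseCheck` with suitable parameters. -/
def primeCheck (p : ℕ) : Bool :=
  force (tier p) fun B => force (Nat.log2 (p ^ 16)) fun A =>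
  force (divisorCount (p - 1) 47 * ((69314 * A + 400000 * (5 * B + 2) ^ 2) * 10 ^ 5) /
    (73194 * 69314 * A) + 1) fun R' =>
  force (bif Nat.ble R' p then p + 1 else R') fun R =>
    baseCheck p B R (Nat.log2 R / Nat.log2 p + 1 + bif Nat.ble 11 p then 1 else 0) (bif p == 2 then 2 else p - 1)

/-- `primeCheck` on `n` consecutive values. -/
def primeScan (n : ℕ) : (p : ℕ) → Bool :=
  Nat.rec (fun _ => true)
    (fun _ ih p => (bif isCandidate p then primeCheck p else true) && force (p + 1) ih) n

end RepunitPairs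

namespace RepunitPairs

theorem force_eq (x : ℕ) (k : ℕ → Bool) : force x k = k x := by
  cases x <;> rfl

theorem dlogCheck_zero {p M a L t x g P q : ℕ} (h : dlogCheck p M a L 0 t x g P q = true) :
    ∃ d, g % M ≠ 1 ∧ t * g ^ d % M = a % M ∧ L < x + d * P ∧ x + d * P < P * p := by
  have h' : (force (nextDigit p M a t g q) fun d =>
        (g % M != 1) && (t * g ^ d % M == a % M) && Nat.blt L (x + d * P) &&
          Nat.blt (x + d * P) (P * p)) = true := h
  rw [force_eq] at h'
  simp only [Bool.and_eq_true, bne_iff_ne, beq_iff_eq, Nat.blt_eq] at h'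
  exact ⟨_, h'.1.1.1, h'.1.1.2, h'.1.2, h'.2⟩

theorem dlogCheck_succ {p M a L n t x g P q : ℕ} (h : dlogCheck p M a L (n + 1) t x g P q = true) :
    ∃ d, dlogCheck p M a L n (t * g ^ d % M) (x + d * P) (g ^ p % M) (P * p) (q * p) = true := by
  have h' : (force (nextDigit p M a t g q) fun d =>
      force (t * g ^ d % M) fun t' =>
      force (x + d * P) fun x' =>
      force (g ^ p % M) fun g' =>
      force (P * p) fun P' =>
      force (q * p) fun q' => dlogCheck p M a L n t' x' g' P' q') = true := h
  simp only [force_eq] at h'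
  exact ⟨_, h'⟩

theorem dlogCheck_sound {p M a b ρ L e : ℕ} (hp : p.Prime) (hM : 2 ≤ M)
    (hb : b.Coprime M) (hρ : (ρ : ZMod M) ^ p ^ e = 1) (n : ℕ) :
    ∀ i t x g q : ℕ, (t : ZMod M) = b * ρ ^ x → (g : ZMod M) = ρ ^ p ^ i →
      dlogCheck p M a L n t x g (p ^ i) q = true →
      ∀ l : ℕ, (b : ZMod M) * ρ ^ l = a → L < l := by
  induction n with
  | zero =>
    intro i t x g q ht hg h l hl
    obtain ⟨d, h1, h2, h3, h4⟩ := dlogCheck_zero h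
    have h5 : ((t * g ^ d : ℕ) : ZMod M) = a := (ZMod.natCast_eq_natCast_iff _ _ _).2 h2
    push_cast at h5
    rw [ht, hg, ← pow_mul, mul_assoc, ← pow_add, ← hl, mul_comm (p ^ i)] at h5
    have hbu : IsUnit (b : ZMod M) := (ZMod.isUnit_iff_coprime _ _).2 hb
    have h6 := hbu.mul_left_cancel h5
    have hρu : IsUnit (ρ : ZMod M) := IsUnit.of_pow_eq_one hρ (pow_ne_zero _ hp.ne_zero)
    obtain ⟨v, hv⟩ := hρu
    rw [← hv] at h6 hρ hg
    have h7 : v ^ (x + d * p ^ i) = v ^ l := by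
      ext; push_cast; exact h6
    rw [pow_eq_pow_iff_modEq] at h7
    have h8 : v ^ p ^ e = 1 := by ext; push_cast; exact hρ
    obtain ⟨j, hj, hje⟩ := (Nat.dvd_prime_pow hp).1 (orderOf_dvd_of_pow_eq_one h8)
    have hij : i < j := by
      by_contra! hji
      apply h1
      have h9 : v ^ p ^ i = 1 := orderOf_dvd_iff_pow_eq_one.1 (hje ▸ pow_dvd_pow p hji)
      have h10 : (g : ZMod M) = (1 : ℕ) := by
        rw [hg, ← Units.val_pow_eq_pow_val, h9]; simp
      have h11 := (ZMod.natCast_eq_natCast_iff _ _ _).1 h10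
      rw [Nat.ModEq, Nat.mod_eq_of_lt (by omega : 1 < M)] at h11
      exact h11
    have h12 : x + d * p ^ i ≡ l [MOD p ^ i * p] := by
      rw [← pow_succ]
      exact h7.of_dvd (hje ▸ pow_dvd_pow p hij)
    by_contra! hlL
    have h13 : (x + d * p ^ i) % (p ^ i * p) = l % (p ^ i * p) := h12
    rw [Nat.mod_eq_of_lt h4, Nat.mod_eq_of_lt (by omega)] at h13
    omega
  | succ n ih =>
    intro i t x g q ht hg h l hl
    obtain ⟨d, h⟩ := dlogCheck_succ h
    refine ih (i + 1) _ _ _ _ ?_ ?_ (by rw [pow_succ]; exact h) l hl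
    · rw [ZMod.natCast_mod]
      push_cast
      rw [ht, hg, pow_add, ← pow_mul]; ring
    · rw [ZMod.natCast_mod, pow_succ, pow_mul]
      push_cast
      rw [hg]

theorem smallCheck_succ {p r Q n w : ℕ} (h : smallCheck p r Q (n + 1) w = true) :
    Q ≤ w ∨ (¬ (w * r * (p - 1) + (r - p)) ∣ (r - 1) * Q ∧ smallCheck p r Q n (w * r) = true) := by
  have h' : (bif Nat.ble Q w then true else
        ((r - 1) * Q % (w * r * (p - 1) + (r - p)) != 0) &&
          force (w * r) (smallCheck p r Q n)) = true := h
  rw [force_eq] at h'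
  by_cases hQ : Q ≤ w
  · exact Or.inl hQ
  · have hb : Nat.ble Q w = false := by
      rw [← Bool.not_eq_true, Nat.ble_eq]; exact hQ
    rw [hb] at h'
    simp only [cond_false, Bool.and_eq_true, bne_iff_ne] at h'
    exact Or.inr ⟨fun hd => h'.1 (Nat.mod_eq_zero_of_dvd hd), h'.2⟩

theorem smallCheck_sound {p r Q : ℕ} (hr : 1 ≤ r) (n : ℕ) :
    ∀ w : ℕ, smallCheck p r Q n w = true →
    ∀ j, w * r ^ j < Q → ¬ (w * r ^ j * r * (p - 1) + (r - p)) ∣ (r - 1) * Q := by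
  induction n with
  | zero => intro w h; exact absurd h Bool.false_ne_true
  | succ n ih =>
    intro w h j hj
    rcases smallCheck_succ h with h | ⟨h1, h2⟩
    · have := Nat.le_mul_of_pos_right w (Nat.pow_pos (n := j) hr)
      omega
    · cases j with
      | zero => simpa using h1
      | succ j =>
        have := ih _ h2 j (by rw [pow_succ] at hj; convert hj using 1; ring)
        convert this using 3
        ring

theorem primePart_spec {p z : ℕ} (n : ℕ) : ∀ j, ∃ c, primePart p z n (p ^ j) = p ^ (j + c) := by
  induction n with
  | zero => exact fun j => ⟨0, rfl⟩
  | succ n ih =>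
    intro j
    have h : primePart p z (n + 1) (p ^ j) =
        bif z % (p ^ j * p) == 0 then primePart p z n (p ^ j * p) else p ^ j := rfl
    rw [h]
    cases hc : (z % (p ^ j * p) == 0)
    · exact ⟨0, rfl⟩
    · obtain ⟨c, hc⟩ := ih (j + 1)
      exact ⟨1 + c, by rw [cond_true, ← pow_succ, hc, add_assoc]⟩

/-- The congruence for large exponents, raised to an even power `E`. -/
theorem pow_congr_of_dvd {p r n m l E : ℕ} (hE : Even E) (hp : 1 ≤ p) (hpr : p ≤ r) (hmn : n ≤ m)
    (h : (p : ℤ) ^ m * (r - 1) = (r : ℤ) ^ (l + 1) * (p - 1) + (r - p)) :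
    ((r ^ E * (p - 1) ^ E : ℕ) : ZMod (p ^ n)) * ((r ^ E : ℕ) : ZMod (p ^ n)) ^ l =
      ((r - p) ^ E : ℕ) := by
  have h0 : ((p : ℤ) : ZMod (p ^ n)) ^ m = 0 := by
    rw [← Nat.sub_add_cancel hmn, pow_add]
    have : ((p : ZMod (p ^ n))) ^ n = 0 := by exact_mod_cast ZMod.natCast_self (p ^ n)
    simp [this]
  have h1 := congrArg (Int.cast : ℤ → ZMod (p ^ n)) h
  push_cast at h0 h1
  rw [h0, zero_mul] at h1
  push_cast [Nat.cast_sub hpr, Nat.cast_sub hp]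
  have h2 : (r : ZMod (p ^ n)) ^ (l + 1) * (p - 1) = - (r - p) := by linear_combination -h1
  calc _ = ((r : ZMod (p ^ n)) ^ (l + 1) * (p - 1)) ^ E := by rw [mul_pow]; ring
    _ = _ := by rw [h2, hE.neg_pow]

theorem smallCheck_excludes {p r m l e n : ℕ} (hp : 2 ≤ p) (hpr : p < r) (hl : 1 ≤ l) (hme : m ≤ e)
    (h : ∑ i ∈ Finset.range m, p ^ i = ∑ i ∈ Finset.range (l + 1), r ^ i)
    (hc : smallCheck p r (p ^ e) n r = true) : False := by
  have hlt := pow_lt_pow_of_repunit_eq hp h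
  have hle : p ^ m ≤ p ^ e := Nat.pow_le_pow_right (by omega) hme
  obtain ⟨k, rfl⟩ := Nat.exists_eq_add_of_le' hl
  refine smallCheck_sound (by omega) n r hc k (by rw [← pow_succ']; omega) ?_
  have hid := repunit_identity h
  have hN : p ^ m * (r - 1) = r * r ^ k * r * (p - 1) + (r - p) := by
    zify [hpr.le, (by omega : 1 ≤ r), (by omega : 1 ≤ p)]
    rw [hid]; ring
  rw [← hN, mul_comm (r - 1)]
  exact Nat.mul_dvd_mul_right (pow_dvd_pow p hme) _

theorem pairCheck_sound {p r E f L m l : ℕ} (hp : p.Prime) (hr : r.Prime) (hpr : p < r) (hf : 1 ≤ f)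
    (hE : Even E) (hpE : (p - 1) ∣ E) (hl : 1 ≤ l)
    (h : ∑ i ∈ Finset.range m, p ^ i = ∑ i ∈ Finset.range (l + 1), r ^ i)
    (hc : pairCheck p r E f L = true) : L < l := by
  have hp2 := hp.two_le
  have hid := repunit_identity h
  have hcop : ∀ n, r.Coprime (p ^ n) := fun n =>
    Nat.Coprime.pow_right _ ((Nat.coprime_primes hr hp).2 hpr.ne')
  have hcop2 : ∀ n, (p - 1).Coprime (p ^ n) := fun n => by
    apply Nat.Coprime.pow_right
    have := Nat.coprime_self_add_right (m := p - 1) (n := 1)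
    rw [Nat.sub_add_cancel hp.one_le] at this
    exact this.2 (Nat.coprime_one_right _)
  obtain ⟨c, hq⟩ := primePart_spec (p := p) (z := r ^ E - 1) 40 0
  simp only [pow_zero, zero_add] at hq
  simp only [pairCheck, force_eq, hq] at hc
  cases hab : ((r - p) ^ E % p ^ c == r ^ E * (p - 1) ^ E % p ^ c)
  · rw [hab, cond_false, Bool.and_eq_true, beq_iff_eq] at hc
    rw [beq_eq_false_iff_ne] at hab
    rcases le_total m c with hmc | hcm
    · exact (smallCheck_excludes hp2 hpr hl hmc h hc.2).elim
    · exfalso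
      apply hab
      have h1 := pow_congr_of_dvd hE hp.one_le hpr.le hcm hid
      have h2 : ((r ^ E : ℕ) : ZMod (p ^ c)) = 1 := by
        have hc1 := hc.1
        have h3 : 1 % p ^ c = 1 := by
          rw [← hc1, Nat.mod_mod]
        have : ((r ^ E : ℕ) : ZMod (p ^ c)) = (1 : ℕ) :=
          (ZMod.natCast_eq_natCast_iff' _ _ _).2 (hc1.trans h3.symm)
        simpa using this
      rw [h2, one_pow, mul_one] at h1
      exact ((ZMod.natCast_eq_natCast_iff' _ _ _).1 h1).symm
  · rw [hab, cond_true, Bool.and_eq_true, ← pow_add] at hc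
    rcases le_total m (c + f) with hmc | hcm
    · exact (smallCheck_excludes hp2 hpr hl hmc h hc.1).elim
    · have h1 := pow_congr_of_dvd hE hp.one_le hpr.le hcm hid
      have hM : 2 ≤ p ^ (c + f) :=
        hp2.trans (Nat.le_self_pow (by omega) p)
      refine dlogCheck_sound (b := r ^ E * (p - 1) ^ E) (ρ := r ^ E) (e := c + f - 1) hp hM ?_ ?_
        (f - 1) 0 _ _ _ _ ?_ ?_ (by rw [pow_zero]; exact hc.2) l ?_
      · exact Nat.Coprime.mul_left ((hcop _).pow_left _) ((hcop2 _).pow_left _)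
      · obtain ⟨k, rfl⟩ := hpE
        have h2 := ZMod.pow_totient ((ZMod.unitOfCoprime r (hcop (c + f))))
        have h3 : (r : ZMod (p ^ (c + f))) ^ (p ^ (c + f)).totient = 1 := by
          rw [← ZMod.coe_unitOfCoprime r (hcop _), ← Units.val_pow_eq_pow_val, h2, Units.val_one]
        rw [Nat.totient_prime_pow hp (by omega)] at h3
        push_cast
        rw [← pow_mul, show (p - 1) * k * p ^ (c + f - 1) = p ^ (c + f - 1) * (p - 1) * k by ring,
          pow_mul, h3, one_pow]
      · rw [ZMod.natCast_mod]; simp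
      · rw [ZMod.natCast_mod]; simp
      · rw [h1, ZMod.natCast_mod]

theorem isCandidate_of_prime {r : ℕ} (hr : r.Prime) : isCandidate r = true := by
  rw [isCandidate, Bool.or_eq_true, Bool.and_eq_true, beq_iff_eq, Nat.blt_eq]
  rcases lt_or_ge r 114 with h | h
  · right
    refine ⟨h, ?_⟩
    revert hr
    interval_cases r <;> first | (intro _; rfl) | (intro hr; norm_num at hr)
  · left
    rw [← Nat.coprime_iff_gcd_eq_one]
    have h1 : r.Coprime (Nat.factorial 113) := by
      rw [Nat.Prime.coprime_iff_not_dvd hr, hr.dvd_factorial]; omega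
    refine h1.coprime_dvd_right ?_
    decide +kernel

theorem scan_sound {p E f L : ℕ} (n : ℕ) : ∀ s, scan p E f L n s = true →
    ∀ r, s ≤ r → r < s + n → r.Prime → ¬ (p = 2 ∧ r = 5) → pairCheck p r E f L = true := by
  induction n with
  | zero => intro s _ r h1 h2; omega
  | succ n ih =>
    intro s h r h1 h2 hr hne
    have h' : ((bif isCandidate s && !(p == 2 && s == 5) then pairCheck p s E f L else true) &&
        force (s + 1) (scan p E f L n)) = true := h
    rw [force_eq, Bool.and_eq_true] at h'
    rcases h1.eq_or_lt with rfl | h1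
    · have h3 := h'.1
      have h4 : (p == 2 && s == 5) = false := by
        rw [← Bool.not_eq_true, Bool.and_eq_true, beq_iff_eq, beq_iff_eq]; exact hne
      rwa [isCandidate_of_prime hr, h4] at h3
    · exact ih _ h'.2 r h1 (by omega) hr hne

theorem primeScan_sound (n : ℕ) : ∀ s, primeScan n s = true →
    ∀ p, s ≤ p → p < s + n → p.Prime → primeCheck p = true := by
  induction n with
  | zero => intro s _ r h1 h2; omega
  | succ n ih =>
    intro s h p h1 h2 hp
    have h' : ((bif isCandidate s then primeCheck s else true) &&
        force (s + 1) (primeScan n)) = true := h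
    rw [force_eq, Bool.and_eq_true] at h'
    rcases h1.eq_or_lt with rfl | h1
    · have h3 := h'.1
      rwa [isCandidate_of_prime hp] at h3
    · exact ih _ h'.2 p h1 (by omega) hp

end RepunitPairs

open Real in
theorem tier_condition {p B : ℕ} (hp : 2 ≤ p) (hB : 4 ≤ B)
    (h : (2146 * (B * (B + 1))) ^ 2 ≤ 10 ^ 4 * p ^ (B - 2)) :
    log (14.5 * (B * (B + 1))) + 0.39 ≤ log p * (B / 2 - 1) := by
  have hB0 : (0 : ℝ) < B := by exact_mod_cast (by omega : 0 < B)
  have hp0 : (0 : ℝ) < p := by exact_mod_cast (by omega : 0 < p)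
  have h1 : (0.39 : ℝ) ≤ log 1.48 := by
    rw [le_log_iff_exp_le (by norm_num)]
    have h2 : exp (0.39 : ℝ) ^ 100 ≤ (1.48 : ℝ) ^ 100 := by
      rw [← exp_nat_mul]
      have h3 : ((100 : ℕ) : ℝ) * 0.39 = (39 : ℕ) * 1 := by norm_num
      rw [h3, exp_nat_mul]
      calc exp 1 ^ 39 ≤ 2.7182818286 ^ 39 := by gcongr; exact exp_one_lt_d9.le
        _ ≤ _ := by norm_num
    exact le_of_pow_le_pow_left₀ (by norm_num) (by norm_num) h2
  have h2 : log (14.5 * (B * (B + 1))) + log 1.48 = log (21.46 * (B * (B + 1))) := by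
    rw [← log_mul (by positivity) (by norm_num)]; congr 1; ring
  have h3 : ((2146 * (B * (B + 1))) ^ 2 : ℝ) ≤ 10 ^ 4 * (p : ℝ) ^ (B - 2) := by exact_mod_cast h
  have h4 : (21.46 * (B * (B + 1)) : ℝ) ^ 2 ≤ (p : ℝ) ^ (B - 2) := by nlinarith
  have h5 := log_le_log (by positivity) h4
  rw [log_pow, log_pow, Nat.cast_sub (by omega)] at h5
  push_cast at h5
  linarith

/-- The divisors of `n` come in pairs `i`, `n / i`. -/
theorem card_divisors_le_add {n k : ℕ} (hn : 0 < n) (hk : n < (k + 1) ^ 2) :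
    n.divisors.card ≤ ((Finset.Icc 1 k).filter fun i => i * i ≤ n ∧ i ∣ n).card +
      ((Finset.Icc 1 k).filter fun i => i * i < n ∧ i ∣ n).card := by
  rw [← Finset.card_filter_add_card_filter_not (s := n.divisors) (fun i => i * i ≤ n)]
  have hsm : ∀ i, i * i ≤ n → i ≤ k := by
    intro i hi
    by_contra! h
    nlinarith
  refine add_le_add (Finset.card_le_card ?_) (Finset.card_le_card_of_injOn (fun i => n / i) ?_ ?_)
  · intro i hi
    simp only [Finset.mem_filter, Nat.mem_divisors, Finset.mem_Icc] at hi ⊢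
    exact ⟨⟨Nat.pos_of_dvd_of_pos hi.1.1 hn, hsm i hi.2⟩, hi.2, hi.1.1⟩
  · intro i hi
    simp only [Finset.coe_filter, Set.mem_ofPred_eq, Nat.mem_divisors, Finset.mem_Icc] at hi ⊢
    obtain ⟨⟨⟨c, hc⟩, _⟩, h2⟩ := hi
    have hi0 : 0 < i := Nat.pos_of_ne_zero (by rintro rfl; omega)
    have hc0 : 0 < c := Nat.pos_of_ne_zero (by rintro rfl; omega)
    rw [hc, Nat.mul_div_cancel_left _ hi0, ← hc]
    have h3 : c < i := by by_contra! h; apply h2; rw [hc]; exact Nat.mul_le_mul_left _ h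
    have h4 : c * c < n := by rw [hc]; exact Nat.mul_lt_mul_of_pos_right h3 hc0
    exact ⟨⟨hc0, hsm c h4.le⟩, h4, ⟨i, by rw [hc]; ring⟩⟩
  · intro a ha b hb hab
    simp only [Finset.coe_filter, Set.mem_ofPred_eq, Nat.mem_divisors] at ha hb hab
    rw [← Nat.div_div_self ha.1.1 hn.ne', hab, Nat.div_div_self hb.1.1 hn.ne']

theorem card_divisors_le_two_mul_sqrt (n : ℕ) : n.divisors.card ≤ 2 * n.sqrt := by
  rcases n.eq_zero_or_pos with rfl | hn
  · simp
  · have h := card_divisors_le_add (k := n.sqrt) hn (Nat.lt_succ_sqrt' n)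
    have h1 : ∀ P : ℕ → Prop, ∀ _ : DecidablePred P, ((Finset.Icc 1 n.sqrt).filter P).card ≤ n.sqrt :=
      fun P _ => (Finset.card_filter_le _ _).trans (by simp)
    have h2 := h1 (fun i => i * i ≤ n ∧ i ∣ n) inferInstance
    have h3 := h1 (fun i => i * i < n ∧ i ∣ n) inferInstance
    omega

theorem card_divisors_le_divisorCount {n k : ℕ} (hn : 0 < n) (hk : n < (k + 1) ^ 2) :
    n.divisors.card ≤ RepunitPairs.divisorCount n k := by
  refine (card_divisors_le_add hn hk).trans (le_of_eq ?_)
  clear hk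
  induction k with
  | zero => rfl
  | succ k ih =>
    have h : RepunitPairs.divisorCount n (k + 1) = RepunitPairs.divisorCount n k +
      (bif Nat.ble ((k + 1) * (k + 1)) n && n % (k + 1) == 0 then
      (bif (k + 1) * (k + 1) == n then 1 else 2) else 0) := rfl
    rw [h, ← ih, ← Finset.insert_Icc_right_eq_Icc_add_one (by omega), Finset.filter_insert,
      Finset.filter_insert]
    have hnot : ∀ P : ℕ → Prop, ∀ _ : DecidablePred P, k + 1 ∉ (Finset.Icc 1 k).filter P := by
      intro P _; simp
    by_cases hd : k + 1 ∣ n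
    · have h0 : (n % (k + 1) == 0) = true := by simpa using Nat.mod_eq_zero_of_dvd hd
      rcases lt_trichotomy ((k + 1) * (k + 1)) n with h1 | h1 | h1
      · have h2 : Nat.ble ((k + 1) * (k + 1)) n = true := by rw [Nat.ble_eq]; exact h1.le
        have h3 : ((k + 1) * (k + 1) == n) = false := by simpa using h1.ne
        rw [if_pos ⟨h1.le, hd⟩, if_pos ⟨h1, hd⟩, Finset.card_insert_of_notMem (hnot _ _),
          Finset.card_insert_of_notMem (hnot _ _), h0, h2, h3]
        simp only [Bool.and_self, cond_true, cond_false]; ring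
      · have h2 : Nat.ble ((k + 1) * (k + 1)) n = true := by rw [Nat.ble_eq]; exact h1.le
        have h3 : ((k + 1) * (k + 1) == n) = true := by simpa using h1
        rw [if_pos ⟨h1.le, hd⟩, if_neg (fun hh => absurd h1 hh.1.ne), Finset.card_insert_of_notMem (hnot _ _),
          h0, h2, h3]
        simp only [Bool.and_self, cond_true]; ring
      · have h2 : Nat.ble ((k + 1) * (k + 1)) n = false := by
          rw [← Bool.not_eq_true, Nat.ble_eq]; omega
        rw [if_neg (fun hh => absurd h1 hh.1.not_gt), if_neg (fun hh => absurd h1 hh.1.not_gt), h2]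
        simp
    · have h0 : (n % (k + 1) == 0) = false := by
        simpa using fun h => hd (Nat.dvd_of_mod_eq_zero h)
      rw [if_neg (fun hh => hd hh.2), if_neg (fun hh => hd hh.2), h0]
      simp

open Real in
theorem baseCheck_sum_lt {p B R k E : ℕ} (hp : p.Prime) (hpl : p ≤ 2304)
    (h : RepunitPairs.baseCheck p B R k E = true) :
    1 ≤ R ∧ 4 ≤ B ∧ log (14.5 * (B * (B + 1))) + 0.39 ≤ log p * (B / 2 - 1) ∧
      (p - 1).divisors.card * (1 / R * (1 + (2.5 * B + 1) ^ 2 / log p)) < 0.73194 := by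
  have hp2 := hp.two_le
  simp only [RepunitPairs.baseCheck, RepunitPairs.force_eq, Bool.and_eq_true, Nat.ble_eq,
    Nat.blt_eq] at h
  obtain ⟨⟨⟨⟨h4, hc⟩, hA0, hsum⟩, hk⟩, -⟩ := h
  set D := RepunitPairs.divisorCount (p - 1) 47
  have hD : (p - 1).divisors.card ≤ D := card_divisors_le_divisorCount (by omega) (by omega)
  set A := Nat.log2 (p ^ 16)
  have hA : 2 ^ A ≤ p ^ 16 := Nat.log2_self_le (by positivity)
  have hR : 0 < R := by
    rcases R.eq_zero_or_pos with h0 | h0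
    · rw [h0] at hsum; omega
    · exact h0
  refine ⟨hR, h4, tier_condition hp2 h4 hc, ?_⟩
  have hlogp : 0 < log p := log_pos (by exact_mod_cast hp2)
  have hA1 : (0 : ℝ) < A := by exact_mod_cast hA0
  have hR1 : (0 : ℝ) < R := by exact_mod_cast hR
  have hlog : 0.69314 * A / 16 ≤ log p := by
    have h1 : ((2 : ℝ)) ^ A ≤ (p : ℝ) ^ 16 := by exact_mod_cast hA
    have h2 := log_le_log (by positivity) h1
    rw [log_pow, log_pow] at h2
    have h3 := log_two_gt_d9
    have h4 : (A : ℝ) * 0.69314 ≤ A * log 2 := by gcongr; linarith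
    push_cast at h2
    linarith
  have hs : (D : ℝ) * ((69314 * A + 400000 * (5 * B + 2) ^ 2) * 10 ^ 5) <
      73194 * 69314 * A * R := by exact_mod_cast hsum
  have hD1 : ((p - 1).divisors.card : ℝ) ≤ D := by exact_mod_cast hD
  calc ((p - 1).divisors.card : ℝ) * (1 / R * (1 + (2.5 * B + 1) ^ 2 / log p))
      ≤ (D : ℝ) * (1 / R * (1 + (2.5 * B + 1) ^ 2 / (0.69314 * A / 16))) := by gcongr
    _ = (D : ℝ) * ((69314 * A + 400000 * (5 * B + 2) ^ 2) * 10 ^ 5) / (10 ^ 5 * 69314 * A * R) := by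
        field_simp; ring
    _ < _ := by
        rw [div_lt_iff₀ (by positivity)]
        linarith

open Real in
theorem baseCheck_excludes {p B R k E r m l : ℕ} (hp : p.Prime) (hE : Even E) (hpE : (p - 1) ∣ E)
    (h : RepunitPairs.baseCheck p B R k E = true) (hr : r.Prime) (hpr : p < r) (hrR : r < R)
    (hne : ¬ (p = 2 ∧ r = 5)) (hm : 1 ≤ m) (hl : 1 ≤ l)
    (heq : ∑ i ∈ Finset.range m, p ^ i = ∑ i ∈ Finset.range (l + 1), r ^ i) : False := by
  have hp2 := hp.two_le
  simp only [RepunitPairs.baseCheck, RepunitPairs.force_eq, Bool.and_eq_true, Nat.ble_eq,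
    Nat.blt_eq] at h
  obtain ⟨⟨⟨⟨h4, hc⟩, -⟩, hk⟩, hscan⟩ := h
  have hpair := RepunitPairs.scan_sound _ _ hscan r (by omega) (by omega) hr hne
  have hL := RepunitPairs.pairCheck_sound hp hr hpr (Nat.le_add_left 1 _) hE hpE hl heq hpair
  have hfact := Fact.mk hp
  have hr0 : (r : ZMod p) ≠ 0 := by
    rw [Ne, ZMod.natCast_eq_zero_iff]
    exact fun hd => hpr.ne ((Nat.prime_dvd_prime_iff_eq hp hr).1 hd)
  have hb := repunit_exponent_bound hp hpr hm (by omega : 0 < p - 1)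
    (ZMod.pow_card_sub_one_eq_one hr0) heq h4 (tier_condition hp2 h4 hc)
  have hlogp : 0 < log p := log_pos (by exact_mod_cast hp2)
  have hlogr : log r ≤ k * log p := by
    rw [← log_pow]
    apply log_le_log (by exact_mod_cast hr.pos)
    exact_mod_cast hrR.le.trans hk
  have h1 : (l : ℝ) * log p ≤ (2.5 * B + 1) ^ 2 * (p - 1 : ℕ) * k * log p := by
    refine hb.trans ?_
    rw [mul_assoc _ (k : ℝ)]
    gcongr
  have h2 : (l : ℝ) ≤ (2.5 * B + 1) ^ 2 * (p - 1 : ℕ) * k := le_of_mul_le_mul_right h1 hlogp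
  have h3 : (l * 4 : ℝ) ≤ (5 * B + 2) ^ 2 * (p - 1 : ℕ) * k := by linarith
  have h5 : l * 4 ≤ (5 * B + 2) ^ 2 * (p - 1) * k := by exact_mod_cast h3
  have h6 := (Nat.le_div_iff_mul_le (by norm_num)).2 h5
  omega

open Real in
theorem sum_bound_of_large {p : ℕ} (hp : 2200 ≤ p) :
    ((p - 1).divisors.card : ℝ) * (1 / p * (1 + (2.5 * (4 : ℕ) + 1) ^ 2 / log p)) < 0.73194 := by
  have hlog : 7.6246 ≤ log p := by
    have h0 : log ((2 : ℝ) ^ 11) ≤ log p :=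
      log_le_log (by positivity) (by exact_mod_cast (by omega : 2 ^ 11 ≤ p))
    rw [log_pow] at h0
    have h1 := log_two_gt_d9
    push_cast at h0
    linarith
  have hp0 : (0 : ℝ) < p := by exact_mod_cast (by omega : 0 < p)
  set s := Nat.sqrt (p - 1)
  have hd : ((p - 1).divisors.card : ℝ) ≤ 2 * s := by
    exact_mod_cast card_divisors_le_two_mul_sqrt (p - 1)
  have hsp : s * s ≤ p := (Nat.sqrt_le _).trans (by omega)
  have h2 : s * 4610 + 1 ≤ p * 100 := by
    rcases le_or_gt s 46 with h | h
    · omega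
    · have : s * 47 ≤ s * s := Nat.mul_le_mul_left s (by omega)
      omega
  have h3 := (Nat.cast_le (α := ℝ)).2 h2
  push_cast at h3
  calc ((p - 1).divisors.card : ℝ) * (1 / p * (1 + (2.5 * (4 : ℕ) + 1) ^ 2 / log p))
      ≤ (2 * (s : ℝ)) * (1 / p * (1 + (2.5 * (4 : ℕ) + 1) ^ 2 / 7.6246)) := by gcongr
    _ = (s : ℝ) * (2 * (1 + (2.5 * (4 : ℕ) + 1) ^ 2 / 7.6246)) / p := by field_simp
    _ < _ := by
        rw [div_lt_iff₀ hp0]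
        have : (0 : ℝ) ≤ s := by positivity
        norm_num
        linarith

theorem eq_three_of_five_pow_add_three {n a : ℕ} (hn : 2 ≤ n) (h : 5 ^ n + 3 = 2 ^ a) : n = 3 := by
  rcases le_or_gt a 7 with ha | ha
  · have h1 : 2 ^ a ≤ 2 ^ 7 := Nat.pow_le_pow_right (by norm_num) ha
    have h2 : n < 4 := by
      by_contra! h3
      have : 5 ^ 4 ≤ 5 ^ n := Nat.pow_le_pow_right (by norm_num) h3
      omega
    interval_cases n
    · exfalso
      interval_cases a <;> omega
    · rfl
  · exfalso
    have h5 : (5 ^ n : ZMod 256) + 3 = 0 := by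
      have h1 : ((5 ^ n + 3 : ℕ) : ZMod 256) = 0 := by
        rw [h, ZMod.natCast_eq_zero_iff]
        exact pow_dvd_pow 2 (by omega : 8 ≤ a)
      exact_mod_cast h1
    have h6 : (5 ^ n : ZMod 257) + 3 = 2 ^ a := by exact_mod_cast congrArg (Nat.cast : ℕ → ZMod 257) h
    have e1 : (5 : ZMod 256) ^ 256 = 1 := by decide +kernel
    have e2 : (5 : ZMod 257) ^ 256 = 1 := by decide +kernel
    have e3 : (2 : ZMod 257) ^ 16 = 1 := by decide +kernel
    rw [pow_eq_pow_mod n e1] at h5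
    rw [pow_eq_pow_mod n e2, pow_eq_pow_mod a e3] at h6
    have key : ∀ i < 256, (5 : ZMod 256) ^ i + 3 = 0 →
        ∀ j < 16, (5 : ZMod 257) ^ i + 3 ≠ 2 ^ j := by decide +kernel
    exact key _ (Nat.mod_lt _ (by norm_num)) h5 _ (Nat.mod_lt _ (by norm_num)) h6

theorem eq_thirty_one_of_two_five {N m n : ℕ} (h2 : IsNSol N 2 m) (h5 : IsNSol N 5 n) : N = 31 := by
  obtain ⟨-, hm, h2⟩ := h2
  obtain ⟨-, hn, h5⟩ := h5
  have hid := repunit_identity (h2.trans h5.symm)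
  have h3 : n = 3 := by
    refine eq_three_of_five_pow_add_three (a := m + 2) hn ?_
    zify
    push_cast at hid
    rw [pow_add]
    linarith
  rw [← h5, h3]
  rfl

theorem base_dvd_sub_one {N r n : ℕ} (h : IsNSol N r n) : r ∣ N - 1 := by
  obtain ⟨-, hn, rfl⟩ := h
  obtain ⟨k, rfl⟩ := Nat.exists_eq_add_of_le' (by omega : 1 ≤ n)
  rw [Finset.sum_range_succ', pow_zero, Nat.add_sub_cancel]
  exact Finset.dvd_sum fun i _ => dvd_pow_self r (by omega)

theorem sum_inv_lt_of_primeCheck {N p m : ℕ} (S : Finset ℕ) (hp : p.Prime) (hp0 : IsNSol N p m)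
    (hS : ∀ r ∈ S, p < r ∧ r.Prime ∧ ∃ n, IsNSol N r n) (hpl : p ≤ 2304)
    (hc : RepunitPairs.primeCheck p = true) : ∑ r ∈ S, (1 : ℝ) / r < 0.73194 := by
  by_cases h25 : p = 2 ∧ 5 ∈ S
  · obtain ⟨rfl, h5⟩ := h25
    obtain ⟨-, -, n, hn⟩ := hS 5 h5
    have hN := eq_thirty_one_of_two_five hp0 hn
    have hsub : S ⊆ {3, 5} := by
      intro r hr
      obtain ⟨h1, h2, n, h3⟩ := hS r hr
      have h4 := base_dvd_sub_one h3
      rw [hN] at h4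
      have h5 : r ≤ 30 := Nat.le_of_dvd (by norm_num) h4
      clear hS hr h3
      interval_cases r <;> first | decide | (exfalso; revert h4; decide) | (exfalso; revert h2; norm_num)
    calc ∑ r ∈ S, (1 : ℝ) / r ≤ ∑ r ∈ ({3, 5} : Finset ℕ), (1 : ℝ) / r :=
          Finset.sum_le_sum_of_subset_of_nonneg hsub (fun _ _ _ => by positivity)
      _ < _ := by
        rw [Finset.sum_pair (by norm_num)]
        norm_num
  · simp only [RepunitPairs.primeCheck, RepunitPairs.force_eq] at hc
    obtain ⟨hR, hB, htier, hlt⟩ := baseCheck_sum_lt hp hpl hc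
    refine (sum_inv_solutions_le S hp hp0 hS hR ?_ hB htier).trans_lt hlt
    intro r hr
    obtain ⟨h1, h2, n, h3⟩ := hS r hr
    by_contra! hrR
    obtain ⟨-, hm, hp1⟩ := hp0
    obtain ⟨-, hn, hr1⟩ := h3
    obtain ⟨l, rfl⟩ := Nat.exists_eq_add_of_le' (by omega : 1 ≤ n)
    refine baseCheck_excludes hp ?_ ?_ hc h2 h1 hrR ?_ (by omega : 1 ≤ m) (by omega : 1 ≤ l)
      (hp1.trans hr1.symm)
    · by_cases h : p = 2
      · subst h; decide
      · have h' : (p == 2) = false := by simpa using h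
        rw [h', cond_false]
        exact hp.even_sub_one h
    · by_cases h : p = 2
      · subst h; decide
      · have h' : (p == 2) = false := by simpa using h
        rw [h', cond_false]
    · rintro ⟨rfl, rfl⟩
      exact h25 ⟨rfl, hr⟩

theorem primeCheck_two : RepunitPairs.primeScan 1 2 = true := by decide +kernel

theorem primeCheck_three_to_ten : RepunitPairs.primeScan 8 3 = true := by decide +kernel

theorem primeCheck_of_lt_300 : RepunitPairs.primeScan 289 11 = true := by decide +kernel

theorem primeCheck_of_lt_2200 : RepunitPairs.primeScan 1900 300 = true := by decide +kernel

theorem primeCheck_of_prime {p : ℕ} (hp : p.Prime) (h : p < 2200) :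
    RepunitPairs.primeCheck p = true := by
  have h2 := hp.two_le
  rcases lt_or_ge p 3 with h3 | h3
  · exact RepunitPairs.primeScan_sound _ _ primeCheck_two p (by omega) (by omega) hp
  rcases lt_or_ge p 11 with h11 | h11
  · exact RepunitPairs.primeScan_sound _ _ primeCheck_three_to_ten p (by omega) (by omega) hp
  rcases lt_or_ge p 300 with h300 | h300
  · exact RepunitPairs.primeScan_sound _ _ primeCheck_of_lt_300 p (by omega) (by omega) hp
  · exact RepunitPairs.primeScan_sound _ _ primeCheck_of_lt_2200 p (by omega) (by omega) hp

open scoped Classical in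
theorem stmt2 (N q₁ m₁ : ℕ) (hN : 2 ≤ N) (hq₁ : q₁.Prime) (h₁ : IsNSol N q₁ m₁)
    (hmin : ∀ q m : ℕ, q.Prime → IsNSol N q m → q₁ ≤ q) :
    ∑ q ∈ (Finset.range (N + 1)).filter (fun q => q₁ < q ∧ q.Prime ∧ ∃ m, IsNSol N q m),
      (1 : ℝ) / q < 0.73194 := by
  have hS : ∀ r ∈ (Finset.range (N + 1)).filter
      (fun q => q₁ < q ∧ q.Prime ∧ ∃ m, IsNSol N q m), q₁ < r ∧ r.Prime ∧ ∃ n, IsNSol N r n :=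
    fun r hr => (Finset.mem_filter.1 hr).2
  rcases lt_or_ge q₁ 2200 with h | h
  · exact sum_inv_lt_of_primeCheck _ hq₁ h₁ hS (by omega) (primeCheck_of_prime hq₁ h)
  · refine (sum_inv_solutions_le _ hq₁ h₁ hS (by omega : 1 ≤ q₁) (fun r hr => (hS r hr).1.le)
      (le_refl 4) (tier_condition (by omega) (le_refl 4) ?_)).trans_lt (sum_bound_of_large h)
    have : 2200 ^ 2 ≤ q₁ ^ 2 := Nat.pow_le_pow_left h 2
    norm_num
    omega
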